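/- Let T be an X-digraph satisfying Property (S) with partition X = A ⊔ B, with basepoint the unique vertex whose hyperlink meets A ∪ A⁻¹, and let φ = (C, m) be a type II Whitehead automorphism with m ∈ B ∪ B⁻¹ whose cut C does not cut the set A ∪ A⁻¹ (i.e., A ∪ A⁻¹ is contained entirely in C or entirely in its complement). Then φ(T) also satisfies Property (S) with the same partition. -/

import Mathlib

/-- An `X`-digraph: a finite directed graph with edges labeled by elements of `X`. -/
structure XDigraph (X : Type) where
  V : Type
  E : Type
  [fintypeV : Fintype V]
  [fintypeE : Fintype E]
  [decV : DecidableEq V]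
  [decE : DecidableEq E]
  init : E → V
  term : E → V
  lab : E → X

attribute [instance] XDigraph.fintypeV XDigraph.fintypeE XDigraph.decV XDigraph.decE

namespace XDigraph

variable {X : Type} (S : XDigraph X)

/-- A dart is an edge together with a direction (`true` = forward). -/
abbrev Dart := S.E × Bool

def dInit (d : S.Dart) : S.V := if d.2 then S.init d.1 else S.term d.1

def dTerm (d : S.Dart) : S.V := if d.2 then S.term d.1 else S.init d.1

/-- The label of a dart, as an element of `X ∪ X⁻¹` (encoded as `X × Bool`). -/
def dLab (d : S.Dart) : X × Bool := (S.lab d.1, d.2)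

def dRev (d : S.Dart) : S.Dart := (d.1, !d.2)

/-- The degree of a vertex: the number of darts pointing into it. -/
def degree (v : S.V) : ℕ := (Finset.univ.filter (fun d : S.Dart => S.dTerm d = v)).card

/-- The hyperlink of a vertex: the set of labels of darts pointing into it. -/
def hyperlink (v : S.V) : Set (X × Bool) := {p | ∃ d : S.Dart, S.dTerm d = v ∧ S.dLab d = p}

/-- `S` is folded if darts into the same vertex have distinct labels. -/
def Folded : Prop := ∀ v : S.V, Set.InjOn S.dLab {d : S.Dart | S.dTerm d = v}

def Adj (u v : S.V) : Prop := ∃ d : S.Dart, S.dInit d = u ∧ S.dTerm d = v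

def Connected : Prop := Nonempty S.V ∧ ∀ u v : S.V, Relation.EqvGen S.Adj u v

/-- A cyclically reduced graph has no leaves (vertices of degree one). -/
def NoLeaf : Prop := ∀ v : S.V, S.degree v ≠ 1

def IsPath (p : List S.Dart) : Prop := p.Chain' (fun d d' => S.dTerm d = S.dInit d')

/-- A path is immersed if no dart is immediately followed by its reverse. -/
def Immersed (p : List S.Dart) : Prop := p.Chain' (fun d d' => d' ≠ S.dRev d)

def IsLoopAt (p : List S.Dart) (v : S.V) : Prop :=
  S.IsPath p ∧ ∀ h : p ≠ [], S.dInit (p.head h) = v ∧ S.dTerm (p.getLast h) = v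

def pathLab (p : List S.Dart) : List (X × Bool) := p.map S.dLab

/-- Adjacency using only edges satisfying `P`. -/
def AdjOn (P : S.E → Prop) (u v : S.V) : Prop :=
  ∃ e : S.E, P e ∧ ((S.init e = u ∧ S.term e = v) ∨ (S.init e = v ∧ S.term e = u))

end XDigraph

section Defs

variable {X : Type} [DecidableEq X]

/-- A list of letters in `X ∪ X⁻¹` is freely reduced: no `x x⁻¹` or `x⁻¹ x` subword. -/
def ReducedList (l : List (X × Bool)) : Prop :=
  List.Chain' (fun p q : X × Bool => p.1 ≠ q.1 ∨ p.2 = q.2) l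

/-- `w` is cyclically reduced: every cyclic permutation of its reduced word is freely reduced. -/
def CyclRed (w : FreeGroup X) : Prop :=
  ∀ l : List (X × Bool), w.toWord.IsRotated l → ReducedList l

/-- `w` is readable as the label of an immersed loop of `S` based at `v`. -/
def Reads (S : XDigraph X) (v : S.V) (w : FreeGroup X) : Prop :=
  ∃ p : List S.Dart, S.Immersed p ∧ S.IsLoopAt p v ∧ S.pathLab p = w.toWord

/-- `S`, with basepoint `base`, is the Stallings graph of the subgroup `H`:
a folded connected core graph whose immersed loops at `base` read exactly the elements of `H`. -/
def PRep (S : XDigraph X) (base : S.V) (H : Subgroup (FreeGroup X)) : Prop :=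
  S.Folded ∧ S.Connected ∧ (∀ v : S.V, v ≠ base → 2 ≤ S.degree v) ∧
    ∀ w : FreeGroup X, w ∈ H ↔ Reads S base w

/-- `S` is the cyclically reduced Stallings graph representing the conjugacy class of `H`:
a folded, connected, cyclically reduced graph whose immersed loops read exactly the
cyclically reduced elements of `F(X)` that are conjugate into `H`. -/
def CRep (S : XDigraph X) (H : Subgroup (FreeGroup X)) : Prop :=
  S.Folded ∧ S.Connected ∧ S.NoLeaf ∧
    ∀ w : FreeGroup X, CyclRed w →
      ((∃ v : S.V, Reads S v w) ↔ ∃ c : FreeGroup X, c * w * c⁻¹ ∈ H)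

/-- The element of `F(X)` given by a single letter of `X ∪ X⁻¹`. -/
def iota (p : X × Bool) : FreeGroup X :=
  if p.2 then FreeGroup.of p.1 else (FreeGroup.of p.1)⁻¹

/-- `φ` is the type II Whitehead automorphism with cut `C` and multiplier `m`. -/
def IsWhiteheadII (φ : FreeGroup X ≃* FreeGroup X) (C : Finset (X × Bool)) (m : X × Bool) :
    Prop :=
  m ∈ C ∧ (m.1, !m.2) ∉ C ∧
    ∀ x : X, φ (FreeGroup.of x) =
      if x = m.1 then FreeGroup.of x
      else (if (x, false) ∈ C then (iota m)⁻¹ else 1) * FreeGroup.of x *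
           (if (x, true) ∈ C then iota m else 1)

/-- The number of edges of `S` labeled `x`. -/
def edgeCount (S : XDigraph X) (x : X) : ℕ :=
  (Finset.univ.filter (fun e : S.E => S.lab e = x)).card

/-- The hyperlink of a vertex, as a finset. -/
def hyperlinkF (S : XDigraph X) (v : S.V) : Finset (X × Bool) :=
  (Finset.univ.filter (fun d : S.Dart => S.dTerm d = v)).image S.dLab

/-- The capacity of the cut `C` in the Whitehead hypergraph of `S`: the number of vertices
whose hyperlink meets both `C` and its complement. -/
def cap (S : XDigraph X) (C : Finset (X × Bool)) : ℕ :=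
  (Finset.univ.filter
    (fun v : S.V => (hyperlinkF S v ∩ C).Nonempty ∧ (hyperlinkF S v \ C).Nonempty)).card

/-- The degree of the letter `m` in the Whitehead hypergraph of `S`: the number of vertices
whose hyperlink contains `m`. -/
def wdeg (S : XDigraph X) (m : X × Bool) : ℕ :=
  (Finset.univ.filter (fun v : S.V => m ∈ hyperlinkF S v)).card

/-- The number of connected components of the subgraph of `S` spanned by the edges
satisfying `P`, on the vertex set `{v | W v}`. -/
noncomputable def componentsCount (S : XDigraph X) (P : S.E → Prop) (W : S.V → Prop) : ℕ :=
  Nat.card (Quotient (Setoid.comap (Subtype.val : {v : S.V // W v} → S.V)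
    (Relation.EqvGen.setoid (S.AdjOn P))))

/-- The connected component of `u` in `S - e₀` has rank one (first Betti number one),
i.e. it has as many edges as vertices. -/
def ComponentRankOne (S : XDigraph X) (e₀ : S.E) (u : S.V) : Prop :=
  Nat.card {e : S.E // e ≠ e₀ ∧ Relation.EqvGen (S.AdjOn (· ≠ e₀)) u (S.init e)} =
    Nat.card {v : S.V // Relation.EqvGen (S.AdjOn (· ≠ e₀)) u v}

/-- Property (L): `S` has a unique `v`-labeled edge `e₀`, and `S - e₀` has exactly two
connected components, at least one of which has rank one. -/
def PropertyL (S : XDigraph X) (v : X) : Prop :=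
  ∃ e₀ : S.E, S.lab e₀ = v ∧ (∀ e : S.E, S.lab e = v → e = e₀) ∧
    componentsCount S (· ≠ e₀) (fun _ => True) = 2 ∧
    ∃ u : S.V, ComponentRankOne S e₀ u

/-- Property (S) for the partition `X = A ⊔ Aᶜ`: `S` is connected and cyclically reduced,
the `A`-edges form a bouquet of single-edge loops at one vertex, and the subgraph spanned
by the remaining edges is connected of rank one. -/
def PropertyS (S : XDigraph X) (A : Set X) : Prop :=
  S.Connected ∧ S.NoLeaf ∧
    (∃ v₀ : S.V, ∀ e : S.E, S.lab e ∈ A → S.init e = v₀ ∧ S.term e = v₀) ∧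
    Nat.card {e : S.E // S.lab e ∉ A} =
      Nat.card {w : S.V // ∃ e : S.E, S.lab e ∉ A ∧ (S.init e = w ∨ S.term e = w)} ∧
    ∀ u w : S.V, (∃ e : S.E, S.lab e ∉ A ∧ (S.init e = u ∨ S.term e = u)) →
      (∃ e : S.E, S.lab e ∉ A ∧ (S.init e = w ∨ S.term e = w)) →
      Relation.EqvGen (S.AdjOn (fun e => S.lab e ∉ A)) u w

/-- An immersion of `X`-digraphs: a label- and orientation-preserving graph map which is
locally injective on links. -/
structure Immersion (S T : XDigraph X) where
  onV : S.V → T.V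
  onE : S.E → T.E
  map_init : ∀ e : S.E, T.init (onE e) = onV (S.init e)
  map_term : ∀ e : S.E, T.term (onE e) = onV (S.term e)
  map_lab : ∀ e : S.E, T.lab (onE e) = S.lab e
  locInj : ∀ (v : S.V) (d d' : S.Dart), S.dTerm d = v → S.dTerm d' = v →
    ((onE d.1, d.2) : T.Dart) = (onE d'.1, d'.2) → d = d'

/-- `K` is a proper free factor of `F(X)`: there is a nontrivial `L` with `F(X) = K ∗ L`. -/
def IsProperFreeFactor (K : Subgroup (FreeGroup X)) : Prop :=
  ∃ L : Subgroup (FreeGroup X), L ≠ ⊥ ∧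
    Function.Bijective (Monoid.Coprod.lift K.subtype L.subtype)

end Defs


namespace WhiteheadS

variable {X : Type}

/-- The formal inverse of a letter. -/
def flip (x : X × Bool) : X × Bool := (x.1, !x.2)

@[simp] lemma flip_flip (x : X × Bool) : flip (flip x) = x := by simp [flip]

@[simp] lemma flip_fst (x : X × Bool) : (flip x).1 = x.1 := rfl

lemma flip_ne (x : X × Bool) : flip x ≠ x := by
  intro h
  have := congrArg Prod.snd h
  simp [flip] at this

lemma mk_cons (x : X × Bool) (l : List (X × Bool)) :
    FreeGroup.mk (x :: l) = FreeGroup.mk [x] * FreeGroup.mk l := by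
  simp [FreeGroup.mul_mk]

lemma mk_append (l r : List (X × Bool)) :
    FreeGroup.mk (l ++ r) = FreeGroup.mk l * FreeGroup.mk r := by
  simp [FreeGroup.mul_mk]

lemma mk_flip (x : X × Bool) : FreeGroup.mk [flip x] = (FreeGroup.mk [x])⁻¹ := by
  simp [FreeGroup.inv_mk, FreeGroup.invRev, flip]

lemma mk_invRev (l : List (X × Bool)) :
    FreeGroup.mk (FreeGroup.invRev l) = (FreeGroup.mk l)⁻¹ := by
  simp [FreeGroup.inv_mk]

lemma invRev_cons (x : X × Bool) (l : List (X × Bool)) :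
    FreeGroup.invRev (x :: l) = FreeGroup.invRev l ++ [flip x] := by
  simp [FreeGroup.invRev, flip]

lemma invRev_snoc (x : X × Bool) (l : List (X × Bool)) :
    FreeGroup.invRev (l ++ [x]) = flip x :: FreeGroup.invRev l := by
  simp [FreeGroup.invRev, flip]

lemma not_rel_iff {x y : X × Bool} : ¬ (x.1 = y.1 → x.2 = y.2) ↔ y = flip x := by
  obtain ⟨a, b⟩ := x
  obtain ⟨c, d⟩ := y
  cases b <;> cases d <;> simp [flip, Prod.ext_iff, eq_comm]

lemma rel_iff {x y : X × Bool} : (x.1 = y.1 → x.2 = y.2) ↔ y ≠ flip x := by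
  rw [ne_eq, ← not_rel_iff, not_not]

lemma isReduced_append {l r : List (X × Bool)} :
    FreeGroup.IsReduced (l ++ r) ↔ FreeGroup.IsReduced l ∧ FreeGroup.IsReduced r ∧
      ∀ x ∈ l.getLast?, ∀ y ∈ r.head?, y ≠ flip x := by
  unfold FreeGroup.IsReduced
  rw [List.isChain_append]
  simp only [rel_iff]

lemma isReduced_snoc {l : List (X × Bool)} {x : X × Bool} :
    FreeGroup.IsReduced (l ++ [x]) ↔
      FreeGroup.IsReduced l ∧ ∀ y ∈ l.getLast?, x ≠ flip y := by
  rw [isReduced_append]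
  simp

lemma isReduced_cons {l : List (X × Bool)} {x : X × Bool} :
    FreeGroup.IsReduced (x :: l) ↔
      FreeGroup.IsReduced l ∧ ∀ y ∈ l.head?, y ≠ flip x := by
  have := isReduced_append (l := [x]) (r := l)
  simpa using this

lemma isReduced_left {l r : List (X × Bool)} (h : FreeGroup.IsReduced (l ++ r)) :
    FreeGroup.IsReduced l := (isReduced_append.1 h).1

lemma isReduced_right {l r : List (X × Bool)} (h : FreeGroup.IsReduced (l ++ r)) :
    FreeGroup.IsReduced r := (isReduced_append.1 h).2.1

/-- Gluing reduced words along a nonempty overlap. -/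
lemma isReduced_glue {l m r : List (X × Bool)} (h₁ : FreeGroup.IsReduced (l ++ m))
    (h₂ : FreeGroup.IsReduced (m ++ r)) (hm : m ≠ []) : FreeGroup.IsReduced (l ++ m ++ r) :=
  FreeGroup.IsReduced.append_overlap h₁ h₂ hm

/-- Appending a letter to a reduced word either keeps it reduced or cancels the last letter. -/
lemma snoc_cases (l : List (X × Bool)) (x : X × Bool) (hl : FreeGroup.IsReduced l) :
    FreeGroup.IsReduced (l ++ [x]) ∨ ∃ l', l = l' ++ [flip x] := by
  rcases List.eq_nil_or_concat l with rfl | ⟨l', y, rfl⟩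
  · left; simp
  · by_cases h : x = flip y
    · right
      refine ⟨l', ?_⟩
      rw [h, flip_flip]
      simp
    · left
      rw [isReduced_snoc]
      refine ⟨hl, ?_⟩
      simpa using h

lemma cycReduced_iff {l : List (X × Bool)} :
    FreeGroup.IsCyclicallyReduced l ↔
      FreeGroup.IsReduced l ∧ ∀ a ∈ l.getLast?, ∀ b ∈ l.head?, b ≠ flip a := by
  unfold FreeGroup.IsCyclicallyReduced
  simp only [rel_iff]

lemma cycReduced_iff_append_self {l : List (X × Bool)} :
    FreeGroup.IsCyclicallyReduced l ↔ FreeGroup.IsReduced (l ++ l) := by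
  rw [cycReduced_iff, isReduced_append]
  tauto

lemma cycReduced_comm {l r : List (X × Bool)} (h : FreeGroup.IsCyclicallyReduced (l ++ r)) :
    FreeGroup.IsCyclicallyReduced (r ++ l) := by
  rcases eq_or_ne l [] with rfl | hl
  · simpa using h
  rcases eq_or_ne r [] with rfl | hr
  · simpa using h
  rw [cycReduced_iff_append_self] at h ⊢
  have h1 : FreeGroup.IsReduced (r ++ l) := by
    have : FreeGroup.IsReduced (l ++ ((r ++ l) ++ r)) := by simpa using h
    exact isReduced_left (isReduced_right this)
  have h2 : FreeGroup.IsReduced (l ++ r) := isReduced_left h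
  have h3 : FreeGroup.IsReduced (r ++ l ++ r) := isReduced_glue h1 h2 hl
  have := isReduced_glue (l := r ++ l) (m := r) (r := l) h3 h1 hr
  simpa using this

lemma isReduced_invRev {l : List (X × Bool)} (h : FreeGroup.IsReduced l) :
    FreeGroup.IsReduced (FreeGroup.invRev l) := by
  induction l with
  | nil => simp
  | cons x l ih =>
    rw [isReduced_cons] at h
    rw [invRev_cons, isReduced_snoc]
    refine ⟨ih h.1, ?_⟩
    intro y hy
    cases l with
    | nil => simp [FreeGroup.invRev] at hy
    | cons z l =>
      rw [invRev_cons] at hy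
      simp at hy
      subst hy
      have := h.2 z (by simp)
      rw [flip_flip]
      exact this.symm

variable [DecidableEq X]

lemma toWord_mk_of {l : List (X × Bool)} (h : FreeGroup.IsReduced l) :
    (FreeGroup.mk l).toWord = l := by
  rw [FreeGroup.toWord_mk, h.reduce_eq]

lemma mk_inj_of {l r : List (X × Bool)} (h : FreeGroup.IsReduced l)
    (h' : FreeGroup.IsReduced r) (e : FreeGroup.mk l = FreeGroup.mk r) : l = r := by
  rw [← toWord_mk_of h, ← toWord_mk_of h', e]

omit [DecidableEq X] in
lemma reducedList_iff {l : List (X × Bool)} : ReducedList l ↔ FreeGroup.IsReduced l := by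
  unfold ReducedList FreeGroup.IsReduced
  have : (fun p q : X × Bool => p.1 ≠ q.1 ∨ p.2 = q.2) =
      fun p q => p.1 = q.1 → p.2 = q.2 := by
    funext p q
    rw [imp_iff_not_or]
  rw [this]
  exact Iff.rfl

lemma cyclRed_iff (w : FreeGroup X) :
    CyclRed w ↔ FreeGroup.IsCyclicallyReduced w.toWord := by
  constructor
  · intro h
    rcases List.eq_nil_or_concat w.toWord with h0 | ⟨l, x, h0⟩
    · rw [h0, cycReduced_iff]; simp
    · rw [List.concat_eq_append] at h0
      have h1 : FreeGroup.IsReduced (x :: l) := by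
        rw [← reducedList_iff]
        apply h
        rw [h0]
        simpa using (List.isRotated_append (l := l) (l' := [x]))
      rw [h0, cycReduced_iff]
      refine ⟨h0 ▸ FreeGroup.isReduced_toWord, ?_⟩
      intro a ha b hb
      simp only [List.getLast?_append, List.getLast?_singleton, Option.some_or,
        Option.mem_some_iff] at ha
      subst ha
      cases l with
      | nil =>
        simp at hb; subst hb; exact (flip_ne _).symm
      | cons c l =>
        simp at hb; subst hb
        exact (isReduced_cons.1 h1).2 _ (by simp)
  · rintro h l ⟨n, rfl⟩
    rw [reducedList_iff]
    rw [← List.take_append_drop (n % w.toWord.length) w.toWord] at h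
    rw [List.rotate_eq_drop_append_take_mod]
    exact (cycReduced_comm h).1

lemma exists_conj_form (g : FreeGroup X) : ∃ p w : List (X × Bool),
    FreeGroup.IsCyclicallyReduced w ∧ FreeGroup.IsReduced (p ++ w ++ FreeGroup.invRev p) ∧
      FreeGroup.mk (p ++ w ++ FreeGroup.invRev p) = g := by
  refine ⟨FreeGroup.reduceCyclically.conjugator g.toWord, FreeGroup.reduceCyclically g.toWord,
    FreeGroup.reduceCyclically.isCyclicallyReduced FreeGroup.isReduced_toWord, ?_, ?_⟩
  · rw [FreeGroup.reduceCyclically.conj_conjugator_reduceCyclically]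
    exact FreeGroup.isReduced_toWord
  · rw [FreeGroup.reduceCyclically.conj_conjugator_reduceCyclically, FreeGroup.mk_toWord]

omit [DecidableEq X] in
/-- Multiplying by a short word on the right preserves an initial segment. -/
lemma prefix_persists (l₁ : List (X × Bool)) : ∀ (r l₂ : List (X × Bool)),
    FreeGroup.IsReduced (l₁ ++ l₂) → r.length ≤ l₂.length →
    ∃ s, FreeGroup.IsReduced (l₁ ++ s) ∧
      FreeGroup.mk (l₁ ++ s) = FreeGroup.mk (l₁ ++ l₂ ++ r) := by
  intro r
  induction r with
  | nil => intro l₂ h _; exact ⟨l₂, h, by simp⟩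
  | cons x r ih =>
    intro l₂ h hlen
    rcases snoc_cases _ x h with h1 | ⟨l', h1⟩
    · obtain ⟨s, hs, e⟩ := ih (l₂ ++ [x]) (by simpa using h1) (by
        simp at hlen ⊢; omega)
      exact ⟨s, hs, by rw [e]; simp⟩
    · rcases List.eq_nil_or_concat l₂ with rfl | ⟨l₃, y, rfl⟩
      · simp at hlen
      · rw [List.concat_eq_append, ← List.append_assoc] at h1
        obtain ⟨h2, h3⟩ := List.append_inj' h1 rfl
        simp at h3
        subst h3
        rw [List.concat_eq_append, ← List.append_assoc] at h
        obtain ⟨s, hs, e⟩ := ih l₃ (isReduced_left h) (by simp at hlen; omega)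
        refine ⟨s, hs, ?_⟩
        rw [e]
        simp only [List.concat_eq_append, mk_append, mk_cons x r, mk_flip]
        group

end WhiteheadS

namespace WhiteheadS

variable {X : Type}

/-- Some dart labeled `x` leads from `u` to `v`. -/
def Step (S : XDigraph X) (u : S.V) (x : X × Bool) (v : S.V) : Prop :=
  ∃ d : S.Dart, S.dInit d = u ∧ S.dLab d = x ∧ S.dTerm d = v

/-- The word `l` is readable along a path from `u` to `v`. -/
def Rd (S : XDigraph X) : S.V → List (X × Bool) → S.V → Prop
  | u, [], v => u = v
  | u, x :: l, v => ∃ w, Step S u x w ∧ Rd S w l v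

variable {S : XDigraph X}

lemma step_flip {u v : S.V} {x : X × Bool} (h : Step S u x v) : Step S v (flip x) u := by
  obtain ⟨⟨e, b⟩, h1, h2, h3⟩ := h
  refine ⟨(e, !b), ?_, ?_, ?_⟩
  · rw [← h3]; cases b <;> simp [XDigraph.dInit, XDigraph.dTerm]
  · rw [← h2]; simp [XDigraph.dLab, flip]
  · rw [← h1]; cases b <;> simp [XDigraph.dInit, XDigraph.dTerm]

lemma step_edge (e : S.E) : Step S (S.init e) (S.lab e, true) (S.term e) :=
  ⟨(e, true), rfl, rfl, rfl⟩

lemma step_inj (hF : S.Folded) {u u' v : S.V} {x : X × Bool} (h : Step S u x v)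
    (h' : Step S u' x v) : u = u' := by
  obtain ⟨d, h1, h2, h3⟩ := h
  obtain ⟨d', h1', h2', h3'⟩ := h'
  have : d = d' := hF v h3 h3' (h2.trans h2'.symm)
  rw [← h1, ← h1', this]

lemma step_det (hF : S.Folded) {u v v' : S.V} {x : X × Bool} (h : Step S u x v)
    (h' : Step S u x v') : v = v' :=
  step_inj hF (step_flip h) (step_flip h')

lemma rd_append {l r : List (X × Bool)} {u v : S.V} :
    Rd S u (l ++ r) v ↔ ∃ w, Rd S u l w ∧ Rd S w r v := by
  induction l generalizing u with
  | nil => simp [Rd]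
  | cons x l ih =>
    simp only [List.cons_append, Rd, ih]
    constructor
    · rintro ⟨w, h, w', h', h''⟩; exact ⟨w', ⟨w, h, h'⟩, h''⟩
    · rintro ⟨w', ⟨w, h, h'⟩, h''⟩; exact ⟨w, h, w', h', h''⟩

lemma rd_single {x : X × Bool} {u v : S.V} : Rd S u [x] v ↔ Step S u x v := by
  simp [Rd]

lemma rd_snoc {l : List (X × Bool)} {x : X × Bool} {u v : S.V} :
    Rd S u (l ++ [x]) v ↔ ∃ w, Rd S u l w ∧ Step S w x v := by
  simp [rd_append, rd_single]

lemma rd_invRev {l : List (X × Bool)} {u v : S.V} (h : Rd S u l v) :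
    Rd S v (FreeGroup.invRev l) u := by
  induction l generalizing u with
  | nil => exact h.symm
  | cons x l ih =>
    obtain ⟨w, h, h'⟩ := h
    rw [invRev_cons, rd_snoc]
    exact ⟨w, ih h', step_flip h⟩

lemma rd_det (hF : S.Folded) {l : List (X × Bool)} {u v v' : S.V} (h : Rd S u l v)
    (h' : Rd S u l v') : v = v' := by
  induction l generalizing u with
  | nil => exact h.symm.trans h'
  | cons x l ih =>
    obtain ⟨w, h1, h2⟩ := h
    obtain ⟨w', h1', h2'⟩ := h'
    obtain rfl := step_det hF h1 h1'
    exact ih h2 h2'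

lemma rd_inj (hF : S.Folded) {l : List (X × Bool)} {u u' v : S.V} (h : Rd S u l v)
    (h' : Rd S u' l v) : u = u' :=
  rd_det hF (rd_invRev h) (rd_invRev h')

lemma rd_redStep (hF : S.Folded) {l l' : List (X × Bool)} {u v : S.V} (h : Rd S u l v)
    (hs : FreeGroup.Red.Step l l') : Rd S u l' v := by
  cases hs with
  | @not L₁ L₂ x b =>
    rw [rd_append] at h ⊢
    obtain ⟨w, h1, w', h2, w'', h3, h4⟩ := h
    have := step_det hF (step_flip h2) h3
    exact ⟨w, h1, this ▸ h4⟩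

lemma rd_red (hF : S.Folded) {l l' : List (X × Bool)} {u v : S.V} (h : Rd S u l v)
    (hs : FreeGroup.Red l l') : Rd S u l' v := by
  induction hs with
  | refl => exact h
  | tail _ hs ih => exact rd_redStep hF ih hs

lemma exists_rd (hC : S.Connected) (u v : S.V) : ∃ l, Rd S u l v := by
  have h := hC.2 u v
  induction h with
  | rel u v h =>
    obtain ⟨d, h1, h2⟩ := h
    exact ⟨[S.dLab d], rd_single.2 ⟨d, h1, rfl, h2⟩⟩
  | refl u => exact ⟨[], rfl⟩
  | symm u v _ ih => obtain ⟨l, h⟩ := ih; exact ⟨_, rd_invRev h⟩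
  | trans u v w _ _ ih1 ih2 =>
    obtain ⟨l, h⟩ := ih1
    obtain ⟨r, h'⟩ := ih2
    exact ⟨l ++ r, rd_append.2 ⟨v, h, h'⟩⟩

lemma rd_of_isPath (p : List S.Dart) (hp : S.IsPath p) (h : p ≠ []) :
    Rd S (S.dInit (p.head h)) (S.pathLab p) (S.dTerm (p.getLast h)) := by
  induction p with
  | nil => exact absurd rfl h
  | cons d p ih =>
    cases p with
    | nil => exact rd_single.2 ⟨d, rfl, rfl, rfl⟩
    | cons d' p =>
      have hp' : List.IsChain (fun d d' => S.dTerm d = S.dInit d') (d :: d' :: p) := hp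
      rw [List.isChain_cons_cons] at hp'
      have := ih hp'.2 (by simp)
      simp only [List.head_cons] at this
      exact ⟨S.dTerm d, ⟨d, rfl, rfl, rfl⟩, by rw [hp'.1]; exact this⟩

lemma exists_path_of_rd {l : List (X × Bool)} {u v : S.V} (h : Rd S u l v) :
    ∃ p : List S.Dart, S.IsPath p ∧ S.pathLab p = l ∧
      ∀ h : p ≠ [], S.dInit (p.head h) = u ∧ S.dTerm (p.getLast h) = v := by
  induction l generalizing u with
  | nil => exact ⟨[], List.IsChain.nil, rfl, fun h => absurd rfl h⟩
  | cons x l ih =>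
    obtain ⟨w, ⟨d, h1, h2, h3⟩, h'⟩ := h
    obtain ⟨p, hp, hl, he⟩ := ih h'
    refine ⟨d :: p, ?_, by simp [XDigraph.pathLab] at hl ⊢; exact ⟨h2, hl⟩, fun _ => ⟨h1, ?_⟩⟩
    · change List.IsChain _ _
      rw [List.isChain_cons]
      refine ⟨?_, hp⟩
      intro y hy
      cases p with
      | nil => simp at hy
      | cons a p =>
        simp at hy; subst hy
        rw [h3]; exact (he (by simp)).1.symm
    · cases p with
      | nil =>
        simp [XDigraph.pathLab] at hl; subst hl
        exact h3.trans h'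
      | cons a p => simpa using (he (by simp)).2

variable [DecidableEq X]

lemma reads_iff (v : S.V) (w : FreeGroup X) : Reads S v w ↔ Rd S v w.toWord v := by
  constructor
  · rintro ⟨p, -, ⟨hp, hl⟩, hw⟩
    rw [← hw]
    rcases eq_or_ne p [] with rfl | h
    · rfl
    · have := rd_of_isPath p hp h
      rwa [(hl h).1, (hl h).2] at this
  · intro h
    obtain ⟨p, hp, hl, he⟩ := exists_path_of_rd h
    refine ⟨p, ?_, ⟨hp, he⟩, hl⟩
    have hr : FreeGroup.IsReduced (S.pathLab p) := hl ▸ FreeGroup.isReduced_toWord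
    unfold FreeGroup.IsReduced XDigraph.pathLab at hr
    rw [List.isChain_map] at hr
    refine List.IsChain.imp ?_ hr
    intro d d' hdd e
    subst e
    rw [rel_iff] at hdd
    exact hdd rfl

lemma rd_toWord (hF : S.Folded) {l : List (X × Bool)} {u v : S.V} (h : Rd S u l v) :
    Rd S u (FreeGroup.mk l).toWord v := by
  rw [FreeGroup.toWord_mk]
  exact rd_red hF h FreeGroup.reduce.red

/-- `g` is the label of a path from `u` to `v`. -/
def Pth (S : XDigraph X) (u : S.V) (g : FreeGroup X) (v : S.V) : Prop := Rd S u g.toWord v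

lemma pth_mk (hF : S.Folded) {l : List (X × Bool)} {u v : S.V} (h : Rd S u l v) :
    Pth S u (FreeGroup.mk l) v := rd_toWord hF h

lemma rd_of_pth {l : List (X × Bool)} {u v : S.V} (hl : FreeGroup.IsReduced l)
    (h : Pth S u (FreeGroup.mk l) v) : Rd S u l v := by
  unfold Pth at h
  rwa [toWord_mk_of hl] at h

lemma pth_one (u : S.V) : Pth S u 1 u := by simp [Pth, Rd]

lemma pth_mul (hF : S.Folded) {u v w : S.V} {g h : FreeGroup X} (h₁ : Pth S u g v)
    (h₂ : Pth S v h w) : Pth S u (g * h) w := by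
  have := pth_mk hF (rd_append.2 ⟨v, h₁, h₂⟩)
  rwa [mk_append, FreeGroup.mk_toWord, FreeGroup.mk_toWord] at this

lemma pth_inv {u v : S.V} {g : FreeGroup X} (h : Pth S u g v) : Pth S v g⁻¹ u := by
  unfold Pth
  rw [FreeGroup.toWord_inv]
  exact rd_invRev h

lemma pth_det (hF : S.Folded) {u v v' : S.V} {g : FreeGroup X} (h : Pth S u g v)
    (h' : Pth S u g v') : v = v' := rd_det hF h h'

lemma exists_pth (hF : S.Folded) (hC : S.Connected) (u v : S.V) : ∃ g, Pth S u g v := by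
  obtain ⟨l, h⟩ := exists_rd hC u v
  exact ⟨_, pth_mk hF h⟩

/-- The subgroup of labels of loops based at `v`. -/
def loops (hF : S.Folded) (v : S.V) : Subgroup (FreeGroup X) where
  carrier := {g | Pth S v g v}
  mul_mem' h h' := pth_mul hF h h'
  one_mem' := pth_one v
  inv_mem' h := pth_inv h

/-- `g` is conjugate into `K`. -/
def ConjInto {G : Type*} [Group G] (K : Subgroup G) (g : G) : Prop := ∃ c, c * g * c⁻¹ ∈ K

lemma conjInto_conj {G : Type*} [Group G] {K : Subgroup G} {g : G} (c : G) :
    ConjInto K (c * g * c⁻¹) ↔ ConjInto K g := by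
  constructor
  · rintro ⟨d, h⟩
    exact ⟨d * c, by simpa [mul_assoc] using h⟩
  · rintro ⟨d, h⟩
    exact ⟨d * c⁻¹, by simpa [mul_assoc] using h⟩

lemma crep_rd_iff {H : Subgroup (FreeGroup X)} (h : CRep S H) {l : List (X × Bool)}
    (hl : FreeGroup.IsCyclicallyReduced l) :
    (∃ v : S.V, Rd S v l v) ↔ ConjInto H (FreeGroup.mk l) := by
  have := h.2.2.2 (FreeGroup.mk l) (by rw [cyclRed_iff, toWord_mk_of hl.1]; exact hl)
  simp only [reads_iff, toWord_mk_of hl.1] at this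
  exact this

/-- Induction on a conjugator, for statements compatible with rotating the conjugated word. -/
lemma conj_induction (P : FreeGroup X → List (X × Bool) → Prop)
    (hnil : ∀ g, P g []) (h0 : ∀ g l, FreeGroup.IsCyclicallyReduced l →
      FreeGroup.IsReduced (g ++ l ++ FreeGroup.invRev g) → P (FreeGroup.mk g) l)
    (hrot : ∀ g x l, FreeGroup.IsCyclicallyReduced (x :: l) →
      (P g (l ++ [x]) ↔ P (g * (FreeGroup.mk [x])⁻¹) (x :: l)))
    (g : FreeGroup X) (l : List (X × Bool)) (hl : FreeGroup.IsCyclicallyReduced l) : P g l := by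
  suffices H : ∀ g : List (X × Bool), FreeGroup.IsReduced g → ∀ l,
      FreeGroup.IsCyclicallyReduced l → P (FreeGroup.mk g) l by
    have := H g.toWord FreeGroup.isReduced_toWord l hl
    rwa [FreeGroup.mk_toWord] at this
  intro g
  induction g using List.reverseRecOn with
  | nil => intro _ l hl; exact h0 [] l hl (by simpa using hl.1)
  | append_singleton g y ih =>
    intro hg l hl
    rcases l with _ | ⟨h, t⟩
    · exact hnil _
    · by_cases e1 : h = flip y
      · have := (hrot (FreeGroup.mk g) h t hl).1
          (ih (isReduced_left hg) _ (cycReduced_comm (l := [h]) hl))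
        rw [e1, mk_flip, inv_inv] at this
        rw [mk_append, e1]
        exact this
      · obtain ⟨t', z, e⟩ : ∃ t' z, h :: t = t' ++ [z] := by
          rcases List.eq_nil_or_concat (h :: t) with e | ⟨t', z, e⟩
          · simp at e
          · exact ⟨t', z, by rw [e, List.concat_eq_append]⟩
        by_cases e2 : z = y
        · subst e2
          have h1 : FreeGroup.IsCyclicallyReduced (z :: t') :=
            cycReduced_comm (r := [z]) (e ▸ hl)
          have := (hrot (FreeGroup.mk g * FreeGroup.mk [z]) z t' h1).2
            (by rw [mul_inv_cancel_right]; exact ih (isReduced_left hg) _ h1)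
          rw [mk_append, e]
          exact this
        · apply h0 _ _ hl
          have r1 : FreeGroup.IsReduced (g ++ [y] ++ h :: t) := by
            rw [isReduced_append]
            exact ⟨hg, hl.1, by simpa using e1⟩
          rw [isReduced_append]
          refine ⟨r1, ?_, ?_⟩
          · exact isReduced_invRev hg
          · rw [e]
            simp only [invRev_snoc]
            intro a ha b hb
            rw [← List.append_assoc, List.getLast?_concat] at ha
            simp at ha hb
            subst ha hb
            intro hh
            apply e2
            have := congrArg flip hh
            simpa using this.symm

lemma conjInto_loops_iff (hF : S.Folded) (hC : S.Connected) (u : S.V) {l : List (X × Bool)}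
    (hl : FreeGroup.IsCyclicallyReduced l) :
    ConjInto (loops hF u) (FreeGroup.mk l) ↔ ∃ v : S.V, Rd S v l v := by
  constructor
  · rintro ⟨c, h⟩
    revert h
    refine conj_induction (fun c l => c * FreeGroup.mk l * c⁻¹ ∈ loops hF u →
      ∃ v : S.V, Rd S v l v) (fun _ _ => ⟨u, rfl⟩) ?_ ?_ c l hl
    · intro g l hl hr h
      rw [← mk_invRev, ← mk_append, ← mk_append] at h
      have := rd_of_pth hr h
      rw [rd_append] at this
      obtain ⟨w, h1, h2⟩ := this
      rw [rd_append] at h1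
      obtain ⟨w', h1, h3⟩ := h1
      have := rd_det hF h1 (by simpa using rd_invRev h2)
      subst this
      exact ⟨w', h3⟩
    · intro g x l _
      have e1 : (∃ v, Rd S v (l ++ [x]) v) ↔ ∃ v, Rd S v (x :: l) v := by
        constructor
        · rintro ⟨v, h⟩
          obtain ⟨w, h1, h2⟩ := rd_snoc.1 h
          exact ⟨w, v, h2, h1⟩
        · rintro ⟨v, w, h1, h2⟩
          exact ⟨w, rd_snoc.2 ⟨v, h2, h1⟩⟩
      have e2 : g * FreeGroup.mk (l ++ [x]) * g⁻¹ = g * (FreeGroup.mk [x])⁻¹ *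
          FreeGroup.mk (x :: l) * (g * (FreeGroup.mk [x])⁻¹)⁻¹ := by
        rw [mk_append, mk_cons x l]; group
      rw [e1, e2]
  · rintro ⟨v, h⟩
    obtain ⟨g, hg⟩ := exists_pth hF hC u v
    exact ⟨g, pth_mul hF (pth_mul hF hg (pth_mk hF h)) (pth_inv hg)⟩

lemma crep_conjInto_iff {H : Subgroup (FreeGroup X)} (h : CRep S H) (u : S.V)
    (g : FreeGroup X) : ConjInto (loops h.1 u) g ↔ ConjInto H g := by
  obtain ⟨p, w, hw, -, rfl⟩ := exists_conj_form g
  rw [mk_append, mk_append, mk_invRev, conjInto_conj, conjInto_conj,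
    conjInto_loops_iff h.1 h.2.1 u hw, crep_rd_iff h hw]

end WhiteheadS

namespace WhiteheadS

variable {X : Type} [DecidableEq X]

/-- `K` contains every `A`-letter occurring in the reduced word of one of its elements, and
the prefix of the word that precedes it. -/
def Star (A : Set X) (K : Subgroup (FreeGroup X)) : Prop :=
  ∀ l₁ x l₂, FreeGroup.IsReduced (l₁ ++ x :: l₂) → FreeGroup.mk (l₁ ++ x :: l₂) ∈ K →
    x.1 ∈ A → FreeGroup.mk l₁ ∈ K ∧ FreeGroup.mk [x] ∈ K

/-- The free factor of words without `A`-letters. -/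
def FB (A : Set X) : Subgroup (FreeGroup X) where
  carrier := {g | ∀ x ∈ g.toWord, x.1 ∉ A}
  mul_mem' := by
    intro g h hg hh x hx
    rw [FreeGroup.toWord_mul] at hx
    have := (FreeGroup.reduce.red (L := g.toWord ++ h.toWord)).sublist.subset hx
    rcases List.mem_append.1 this with h | h
    · exact hg x h
    · exact hh x h
  one_mem' := by simp
  inv_mem' := by
    intro g hg x hx
    rw [FreeGroup.toWord_inv] at hx
    simp only [FreeGroup.invRev, List.mem_reverse, List.mem_map] at hx
    obtain ⟨y, hy, rfl⟩ := hx
    exact hg y hy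

lemma mk_mem_FB {A : Set X} {l : List (X × Bool)} (h : ∀ x ∈ l, x.1 ∉ A) :
    FreeGroup.mk l ∈ FB A := by
  intro x hx
  rw [FreeGroup.toWord_mk] at hx
  exact h x ((FreeGroup.reduce.red (L := l)).sublist.subset hx)

lemma letters_of_mem_FB {A : Set X} {l : List (X × Bool)} (hl : FreeGroup.IsReduced l)
    (h : FreeGroup.mk l ∈ FB A) : ∀ x ∈ l, x.1 ∉ A := by
  intro x hx
  exact h x (by rwa [toWord_mk_of hl])

lemma FB_induction {A : Set X} (P : FreeGroup X → Prop) (h1 : P 1)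
    (hs : ∀ x l, x.1 ∉ A → P (FreeGroup.mk l) → P (FreeGroup.mk (l ++ [x])))
    (g : FreeGroup X) (hg : g ∈ FB A) : P g := by
  suffices H : ∀ l : List (X × Bool), (∀ x ∈ l, x.1 ∉ A) → P (FreeGroup.mk l) by
    have := H g.toWord hg
    rwa [FreeGroup.mk_toWord] at this
  intro l
  induction l using List.reverseRecOn with
  | nil => intro _; exact h1
  | append_singleton l x ih =>
    intro h
    exact hs x l (h x (by simp)) (ih fun y hy => h y (by simp [hy]))

omit [DecidableEq X] in
lemma mk_single_eq (x : X × Bool) : FreeGroup.mk [x] = FreeGroup.of x.1 ∨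
    FreeGroup.mk [x] = (FreeGroup.of x.1)⁻¹ := by
  obtain ⟨a, b⟩ := x
  cases b
  · right; simp [FreeGroup.of, FreeGroup.inv_mk, FreeGroup.invRev]
  · left; rfl

omit [DecidableEq X] in
lemma mk_single_mem_iff {K : Subgroup (FreeGroup X)} (x : X × Bool) :
    FreeGroup.mk [x] ∈ K ↔ FreeGroup.of x.1 ∈ K := by
  rcases mk_single_eq x with h | h <;> rw [h]
  exact K.inv_mem_iff

/-- The splittings of `g` at an `A`-letter are compatible with `K`. -/
def GoodSplits (A : Set X) (K : Subgroup (FreeGroup X)) (g : FreeGroup X) : Prop :=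
  ∀ l₁ x l₂, g.toWord = l₁ ++ x :: l₂ → x.1 ∈ A → FreeGroup.mk l₁ ∈ K ∧ FreeGroup.mk [x] ∈ K

lemma GoodSplits.mul_letter {A : Set X} {K : Subgroup (FreeGroup X)} {g : FreeGroup X}
    (hg : GoodSplits A K g) (y : X × Bool)
    (hy : y.1 ∈ A → g ∈ K ∧ FreeGroup.mk [y] ∈ K) :
    GoodSplits A K (g * FreeGroup.mk [y]) := by
  have e : g * FreeGroup.mk [y] = FreeGroup.mk (g.toWord ++ [y]) := by
    rw [mk_append, FreeGroup.mk_toWord]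
  intro l₁ x l₂ h hx
  rcases snoc_cases g.toWord y FreeGroup.isReduced_toWord with h1 | ⟨l', h1⟩
  · rw [e, toWord_mk_of h1] at h
    rcases List.eq_nil_or_concat l₂ with rfl | ⟨l₃, z, rfl⟩
    · obtain ⟨h2, h3⟩ := List.append_inj' h rfl
      simp at h3
      subst h3
      rw [← h2, FreeGroup.mk_toWord]
      exact hy hx
    · rw [List.concat_eq_append, ← List.cons_append, ← List.append_assoc] at h
      obtain ⟨h2, -⟩ := List.append_inj' h rfl
      exact hg _ _ _ h2 hx
  · have hr : FreeGroup.IsReduced (l' ++ [flip y]) := h1 ▸ FreeGroup.isReduced_toWord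
    have : FreeGroup.mk (g.toWord ++ [y]) = FreeGroup.mk l' := by
      rw [h1, mk_append, mk_append, mk_flip, inv_mul_cancel_right]
    rw [e, this, toWord_mk_of (isReduced_left hr)] at h
    refine hg l₁ x (l₂ ++ [flip y]) ?_ hx
    rw [h1, h]; simp

lemma GoodSplits.mul_FB {A : Set X} {K : Subgroup (FreeGroup X)} {g b : FreeGroup X}
    (hg : GoodSplits A K g) (hb : b ∈ FB A) : GoodSplits A K (g * b) := by
  refine FB_induction (fun b => GoodSplits A K (g * b)) (by simpa using hg) ?_ b hb
  intro x l hx h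
  have := h.mul_letter x (fun hx' => absurd hx' hx)
  rwa [mul_assoc, ← mk_append] at this

lemma star_closure {A A' : Set X} {R : Set (FreeGroup X)}
    (hR : ∀ g ∈ R, g ∈ FB A) : Star A (Subgroup.closure (FreeGroup.of '' A' ∪ R)) := by
  set K := Subgroup.closure (FreeGroup.of '' A' ∪ R) with hK
  have key : ∀ g ∈ K, GoodSplits A K g := by
    intro g hg
    induction hg using Subgroup.closure_induction_right with
    | one => intro l₁ x l₂ h; simp at h
    | mul_right g hg' y hy ih =>
      rcases hy with ⟨a, ha, rfl⟩ | hy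
      · exact ih.mul_letter (a, true) fun _ => ⟨hg', Subgroup.subset_closure (Or.inl ⟨a, ha, rfl⟩)⟩
      · exact ih.mul_FB (hR y hy)
    | mul_inv_cancel g hg' y hy ih =>
      rcases hy with ⟨a, ha, rfl⟩ | hy
      · have : (FreeGroup.of a)⁻¹ = FreeGroup.mk [(a, false)] := rfl
        rw [this]
        refine ih.mul_letter (a, false) fun _ => ⟨hg', ?_⟩
        rw [mk_single_mem_iff]
        exact Subgroup.subset_closure (Or.inl ⟨a, ha, rfl⟩)
      · exact ih.mul_FB ((FB A).inv_mem (hR y hy))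
  intro l₁ x l₂ h hm hx
  exact key _ hm l₁ x l₂ (toWord_mk_of h) hx

/-- In a conjugate `g w g⁻¹ ∈ K`, the path up to an `A`-letter of `w` belongs to `K`. -/
lemma Star.conj {A : Set X} {K : Subgroup (FreeGroup X)} (hK : Star A K) (g : FreeGroup X)
    {l : List (X × Bool)} (hl : FreeGroup.IsCyclicallyReduced l)
    (h : g * FreeGroup.mk l * g⁻¹ ∈ K) (s₁ : List (X × Bool)) (x : X × Bool)
    (s₂ : List (X × Bool)) (e : l = s₁ ++ x :: s₂) (hx : x.1 ∈ A) :
    g * FreeGroup.mk s₁ ∈ K := by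
  revert h s₁ x s₂ e hx
  refine conj_induction (fun g l => g * FreeGroup.mk l * g⁻¹ ∈ K → ∀ s₁ x s₂,
    l = s₁ ++ x :: s₂ → x.1 ∈ A → g * FreeGroup.mk s₁ ∈ K) ?_ ?_ ?_ g l hl
  · intro g _ s₁ x s₂ h; simp at h
  · intro g l _ hr h s₁ x s₂ e hx
    subst e
    rw [← mk_invRev, ← mk_append, ← mk_append] at h
    rw [← mk_append]
    have e : g ++ (s₁ ++ x :: s₂) ++ FreeGroup.invRev g =
      (g ++ s₁) ++ x :: (s₂ ++ FreeGroup.invRev g) := by simp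
    rw [e] at h hr
    exact (hK _ _ _ hr h hx).1
  · intro g x l _
    have e2 : g * FreeGroup.mk (l ++ [x]) * g⁻¹ = g * (FreeGroup.mk [x])⁻¹ *
        FreeGroup.mk (x :: l) * (g * (FreeGroup.mk [x])⁻¹)⁻¹ := by
      rw [mk_append, mk_cons x l]; group
    rw [← e2]
    refine imp_congr_right fun hc => ?_
    have hc' : g * FreeGroup.mk l * (FreeGroup.mk [x] * g⁻¹) ∈ K := by
      rw [mk_append] at hc; simpa [mul_assoc, -FreeGroup.mul_mk, -FreeGroup.inv_mk] using hc
    constructor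
    · intro h s₁ a s₂ e ha
      cases s₁ with
      | nil =>
        simp at e
        obtain ⟨rfl, rfl⟩ := e
        have h1 := h l x [] (by simp) ha
        have := K.mul_mem (K.inv_mem hc') h1
        have e3 : (g * FreeGroup.mk l * (FreeGroup.mk [x] * g⁻¹))⁻¹ * (g * FreeGroup.mk l) =
          g * (FreeGroup.mk [x])⁻¹ * FreeGroup.mk [] := by
          rw [← FreeGroup.one_eq_mk]; group
        rwa [e3] at this
      | cons y s₁ =>
        simp at e
        obtain ⟨rfl, rfl⟩ := e
        have := h s₁ a (s₂ ++ [x]) (by simp) ha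
        rw [mk_cons x s₁]
        simpa [mul_assoc, -FreeGroup.mul_mk, -FreeGroup.inv_mk] using this
    · intro h s₁ a s₂ e ha
      rcases List.eq_nil_or_concat s₂ with rfl | ⟨l₃, z, rfl⟩
      · obtain ⟨h2, h3⟩ := List.append_inj' e rfl
        simp at h3
        subst h2 h3
        have h1 := h [] x l (by simp) ha
        have := K.mul_mem hc' h1
        rw [← FreeGroup.one_eq_mk] at this
        simpa [mul_assoc, -FreeGroup.mul_mk, -FreeGroup.inv_mk] using this
      · rw [List.concat_eq_append, ← List.cons_append, ← List.append_assoc] at e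
        obtain ⟨h2, h3⟩ := List.append_inj' e rfl
        simp at h3
        subst h2 h3
        have := h (x :: s₁) a l₃ (by simp) ha
        rw [mk_cons x s₁] at this
        simpa [mul_assoc, -FreeGroup.mul_mk, -FreeGroup.inv_mk] using this

end WhiteheadS

namespace WhiteheadS

variable {X : Type} [DecidableEq X] {S : XDigraph X}

omit [DecidableEq X] in
lemma exists_step_ne (hF : S.Folded) (hN : S.NoLeaf) {u v : S.V} {x : X × Bool}
    (h : Step S u x v) : ∃ y w, y ≠ flip x ∧ Step S v y w := by
  obtain ⟨d, -, h2, h3⟩ := h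
  have hmem : d ∈ Finset.univ.filter (fun d : S.Dart => S.dTerm d = v) := by simp [h3]
  have hcard : 1 < (Finset.univ.filter (fun d : S.Dart => S.dTerm d = v)).card := by
    have h1 := hN v
    unfold XDigraph.degree at h1
    have := Finset.card_pos.2 ⟨d, hmem⟩
    omega
  obtain ⟨d', hd', hne⟩ := Finset.exists_mem_ne hcard d
  simp only [Finset.mem_filter, Finset.mem_univ, true_and] at hd'
  refine ⟨flip (S.dLab d'), S.dInit d', ?_, step_flip ⟨d', rfl, rfl, hd'⟩⟩
  intro e
  have := congrArg flip e
  rw [flip_flip, flip_flip, ← h2] at this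
  exact hne (hF v hd' h3 this)

lemma exists_extension (hF : S.Folded) (hN : S.NoLeaf) {u v : S.V} {P : List (X × Bool)}
    (hP : FreeGroup.IsReduced P) (hP0 : P ≠ []) (h : Rd S u P v) (n : ℕ) :
    ∃ l w, l.length = n ∧ FreeGroup.IsReduced (P ++ l) ∧ Rd S u (P ++ l) w := by
  induction n with
  | zero => exact ⟨[], v, rfl, by simpa using hP, by simpa using h⟩
  | succ n ih =>
    obtain ⟨l, w, hl, hr, hw⟩ := ih
    obtain ⟨Q, x, e⟩ : ∃ Q x, P ++ l = Q ++ [x] := by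
      rcases List.eq_nil_or_concat (P ++ l) with e | ⟨t', z, e⟩
      · simp at e; exact absurd e.1 hP0
      · exact ⟨t', z, by rw [e, List.concat_eq_append]⟩
    rw [e] at hw
    obtain ⟨w', -, hs⟩ := rd_snoc.1 hw
    obtain ⟨y, z, hy, hz⟩ := exists_step_ne hF hN hs
    refine ⟨l ++ [y], z, by simp [hl], ?_, ?_⟩
    · rw [← List.append_assoc, isReduced_snoc, e]
      exact ⟨e ▸ hr, by simpa using hy⟩
    · rw [← List.append_assoc, e, rd_snoc]
      exact ⟨w, hw, hz⟩

/-- Every immersed path starting at `u` extends to a loop at `u` with reduced label. -/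
lemma exists_return (hF : S.Folded) (hC : S.Connected) (hN : S.NoLeaf) {u v : S.V}
    {P : List (X × Bool)} (hP : FreeGroup.IsReduced P) (hP0 : P ≠ []) (h : Rd S u P v) :
    ∃ s, FreeGroup.IsReduced (P ++ s) ∧ FreeGroup.mk (P ++ s) ∈ loops hF u := by
  choose r hr using fun w => exists_rd hC w u
  obtain ⟨l, w, hl, hred, hw⟩ := exists_extension hF hN hP hP0 h
    (Finset.univ.sup fun w => (r w).length)
  obtain ⟨s, hs, e⟩ := prefix_persists P (r w) l hred (by
    rw [hl]; exact Finset.le_sup (f := fun w => (r w).length) (Finset.mem_univ w))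
  refine ⟨s, hs, ?_⟩
  rw [e]
  exact pth_mk hF (rd_append.2 ⟨w, hw, hr w⟩)

lemma bouquet_step (hF : S.Folded) (hC : S.Connected) (hN : S.NoLeaf) {A : Set X} {u v : S.V}
    (hS : Star A (loops hF u)) {P : List (X × Bool)} {x : X × Bool}
    (hP : FreeGroup.IsReduced (P ++ [x])) (h : Rd S u (P ++ [x]) v) (hx : x.1 ∈ A) :
    Rd S u P u ∧ Step S u x u := by
  obtain ⟨s, hs, hm⟩ := exists_return hF hC hN hP (by simp) h
  have e : P ++ [x] ++ s = P ++ x :: s := by simp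
  rw [e] at hs hm
  obtain ⟨h1, h2⟩ := hS P x s hs hm hx
  exact ⟨rd_of_pth (isReduced_left hP) h1, rd_single.1 (rd_of_pth (by simp) h2)⟩

lemma bouquet (hF : S.Folded) (hC : S.Connected) (hN : S.NoLeaf) {A : Set X} {u : S.V}
    (hS : Star A (loops hF u)) (e : S.E) (he : S.lab e ∈ A) : S.init e = u ∧ S.term e = u := by
  obtain ⟨g, hg⟩ := exists_pth hF hC u (S.init e)
  have hst := step_edge e
  rcases snoc_cases g.toWord (S.lab e, true) FreeGroup.isReduced_toWord with h | ⟨l, h⟩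
  · obtain ⟨h1, h2⟩ := bouquet_step hF hC hN hS h (rd_snoc.2 ⟨_, hg, hst⟩) he
    have h3 := rd_det hF hg h1
    rw [h3] at hst
    exact ⟨h3, step_det hF hst h2⟩
  · have hr : FreeGroup.IsReduced (l ++ [flip (S.lab e, true)]) := h ▸ FreeGroup.isReduced_toWord
    have hg' : Rd S u (l ++ [flip (S.lab e, true)]) (S.init e) := h ▸ hg
    obtain ⟨h1, h2⟩ := bouquet_step hF hC hN hS hr hg' he
    have h3 := rd_det hF hg' (rd_snoc.2 ⟨u, h1, h2⟩)
    rw [h3] at hst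
    have := step_flip h2
    rw [flip_flip] at this
    exact ⟨h3, step_det hF hst this⟩

omit [DecidableEq X] in
lemma adjOn_of_bouquet (hC : S.Connected) {A : Set X} {v₀ : S.V}
    (hb : ∀ e, S.lab e ∈ A → S.init e = v₀ ∧ S.term e = v₀) (u w : S.V) :
    Relation.EqvGen (S.AdjOn (fun e => S.lab e ∉ A)) u w := by
  have h := hC.2 u w
  induction h with
  | rel u v h =>
    obtain ⟨⟨e, b⟩, h1, h2⟩ := h
    by_cases he : S.lab e ∈ A
    · obtain ⟨h3, h4⟩ := hb e he
      have : u = v := by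
        rw [← h1, ← h2]
        cases b <;> simp [XDigraph.dInit, XDigraph.dTerm, h3, h4]
      rw [this]
      exact Relation.EqvGen.refl _
    · refine Relation.EqvGen.rel _ _ ⟨e, he, ?_⟩
      cases b
      · right; exact ⟨h2, h1⟩
      · left; exact ⟨h1, h2⟩
  | refl u => exact Relation.EqvGen.refl _
  | symm u v _ ih => exact Relation.EqvGen.symm _ _ ih
  | trans u v w _ _ ih1 ih2 => exact Relation.EqvGen.trans _ _ _ ih1 ih2

omit [DecidableEq X] in
lemma touched_of_bouquet (hC : S.Connected) {A : Set X} {v₀ : S.V}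
    (hb : ∀ e, S.lab e ∈ A → S.init e = v₀ ∧ S.term e = v₀) {e₀ : S.E} (he₀ : S.lab e₀ ∉ A)
    (w : S.V) : ∃ e : S.E, S.lab e ∉ A ∧ (S.init e = w ∨ S.term e = w) := by
  have key : ∀ u w, Relation.EqvGen (S.AdjOn (fun e => S.lab e ∉ A)) u w →
      ((∃ e : S.E, S.lab e ∉ A ∧ (S.init e = u ∨ S.term e = u)) ↔
        ∃ e : S.E, S.lab e ∉ A ∧ (S.init e = w ∨ S.term e = w)) := by
    intro u w h
    induction h with
    | rel u v h =>
      obtain ⟨e, he, h⟩ := h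
      refine iff_of_true ⟨e, he, ?_⟩ ⟨e, he, ?_⟩ <;> tauto
    | refl u => exact Iff.rfl
    | symm u v _ ih => exact ih.symm
    | trans u v w _ _ ih1 ih2 => exact ih1.trans ih2
  exact (key (S.init e₀) w (adjOn_of_bouquet hC hb _ _)).1 ⟨e₀, he₀, Or.inl rfl⟩

omit [DecidableEq X] in
lemma card_touched (hC : S.Connected) {A : Set X} {v₀ : S.V}
    (hb : ∀ e, S.lab e ∈ A → S.init e = v₀ ∧ S.term e = v₀) {e₀ : S.E} (he₀ : S.lab e₀ ∉ A) :
    Nat.card {w : S.V // ∃ e : S.E, S.lab e ∉ A ∧ (S.init e = w ∨ S.term e = w)} =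
      Nat.card S.V :=
  Nat.card_congr (Equiv.subtypeUnivEquiv (touched_of_bouquet hC hb he₀))

/-- In a graph whose `A`-edges form a bouquet at `v₀`, the loop group at `v₀` is generated by
the `A`-letters and the loops without `A`-letters. -/
lemma loops_eq_closure (hF : S.Folded) {A : Set X} {v₀ : S.V}
    (hb : ∀ e, S.lab e ∈ A → S.init e = v₀ ∧ S.term e = v₀) :
    loops hF v₀ = Subgroup.closure (FreeGroup.of '' {x | x ∈ A ∧ ∃ e, S.lab e = x} ∪
      ((loops hF v₀ ⊓ FB A : Subgroup (FreeGroup X)) : Set (FreeGroup X))) := by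
  set K := Subgroup.closure (FreeGroup.of '' {x | x ∈ A ∧ ∃ e, S.lab e = x} ∪
      ((loops hF v₀ ⊓ FB A : Subgroup (FreeGroup X)) : Set (FreeGroup X))) with hK
  apply le_antisymm
  · have key : ∀ l v, Rd S v₀ l v → ∃ k ∈ K, ∃ b ∈ FB A, FreeGroup.mk l = k * b ∧
        Pth S v₀ b v := by
      intro l
      induction l using List.reverseRecOn with
      | nil =>
        rintro v rfl
        exact ⟨1, K.one_mem, 1, (FB A).one_mem, by rw [← FreeGroup.one_eq_mk]; simp, pth_one _⟩
      | append_singleton l x ih =>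
        intro v h
        obtain ⟨w, h1, h2⟩ := rd_snoc.1 h
        obtain ⟨k, hk, b, hbB, e, hp⟩ := ih w h1
        by_cases hx : x.1 ∈ A
        · obtain ⟨⟨ed, bo⟩, h3, h4, h5⟩ := h2
          have hx' : S.lab ed = x.1 := by rw [← h4]; rfl
          obtain ⟨h6, h7⟩ := hb ed (hx' ▸ hx)
          have hw : w = v₀ := by
            rw [← h3]; cases bo <;> simp [XDigraph.dInit, h6, h7]
          have hv : v = v₀ := by
            rw [← h5]; cases bo <;> simp [XDigraph.dTerm, h6, h7]
          refine ⟨k * b * FreeGroup.mk [x], ?_, 1, (FB A).one_mem, ?_, ?_⟩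
          · refine K.mul_mem (K.mul_mem hk ?_) ?_
            · exact Subgroup.subset_closure (Or.inr ⟨by rw [hw] at hp; exact hp, hbB⟩)
            · rw [mk_single_mem_iff]
              exact Subgroup.subset_closure (Or.inl ⟨x.1, ⟨hx, ed, hx'⟩, rfl⟩)
          · rw [mk_append, e, mul_one]
          · rw [hv]; exact pth_one _
        · refine ⟨k, hk, b * FreeGroup.mk [x], (FB A).mul_mem hbB (mk_mem_FB (by simpa using hx)),
            ?_, pth_mul hF hp (pth_mk hF (rd_single.2 h2))⟩
          rw [mk_append, e, mul_assoc]
    intro g hg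
    obtain ⟨k, hk, b, hb', e, hp⟩ := key _ _ hg
    rw [FreeGroup.mk_toWord] at e
    rw [e]
    exact K.mul_mem hk (Subgroup.subset_closure (Or.inr ⟨hp, hb'⟩))
  · rw [hK, Subgroup.closure_le]
    rintro g (⟨x, ⟨hx, e, rfl⟩, rfl⟩ | hg)
    · have := pth_mk hF (rd_single.2 (step_edge e))
      rw [(hb e hx).1, (hb e hx).2] at this
      exact this
    · exact hg.1

lemma exists_mem_B_letter (hF : S.Folded) (hC : S.Connected) (hN : S.NoLeaf) {A : Set X}
    (u : S.V) {e : S.E} (he : S.lab e ∉ A) : ¬ loops hF u ≤ FB Aᶜ := by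
  intro hle
  have key : ∀ (P : List (X × Bool)) v, FreeGroup.IsReduced (P) → Rd S u P v →
      ∀ x ∈ P, x.1 ∈ A := by
    intro P v hP h x hx
    obtain ⟨s, hs, hm⟩ := exists_return hF hC hN hP (List.ne_nil_of_mem hx) h
    have := letters_of_mem_FB hs (hle hm) x (by simp [hx])
    simpa using this
  obtain ⟨g, hg⟩ := exists_pth hF hC u (S.init e)
  rcases snoc_cases g.toWord (S.lab e, true) FreeGroup.isReduced_toWord with h | ⟨l, h⟩
  · exact he (key _ _ h (rd_snoc.2 ⟨_, hg, step_edge e⟩) (S.lab e, true) (by simp))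
  · exact he (key _ _ FreeGroup.isReduced_toWord hg (flip (S.lab e, true)) (by simp [h]))

end WhiteheadS

namespace WhiteheadS

variable {X : Type} [DecidableEq X] {S : XDigraph X}

/-- The subgraph of edges whose label is not in `A`. -/
noncomputable def subgraphCompl (S : XDigraph X) (A : Set X) : XDigraph X :=
  letI : Fintype {e : S.E // S.lab e ∉ A} := Fintype.ofFinite _
  { V := S.V
    E := {e : S.E // S.lab e ∉ A}
    init := fun e => S.init e.1
    term := fun e => S.term e.1
    lab := fun e => S.lab e.1 }

omit [DecidableEq X] in
lemma step_subgraphCompl {A : Set X} {u v : S.V} {x : X × Bool} :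
    Step (subgraphCompl S A) u x v ↔ Step S u x v ∧ x.1 ∉ A := by
  constructor
  · rintro ⟨⟨⟨e, he⟩, b⟩, h1, h2, h3⟩
    refine ⟨⟨(e, b), h1, h2, h3⟩, ?_⟩
    rw [← h2]
    exact he
  · rintro ⟨⟨⟨e, b⟩, h1, h2, h3⟩, hx⟩
    refine ⟨(⟨e, ?_⟩, b), h1, h2, h3⟩
    rw [← h2] at hx
    exact hx

omit [DecidableEq X] in
lemma rd_subgraphCompl {A : Set X} {u v : S.V} {l : List (X × Bool)} :
    Rd (subgraphCompl S A) u l v ↔ Rd S u l v ∧ ∀ x ∈ l, x.1 ∉ A := by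
  induction l generalizing u with
  | nil => exact ⟨fun h => ⟨h, by simp⟩, fun h => h.1⟩
  | cons x l ih =>
    simp only [Rd, List.mem_cons, forall_eq_or_imp]
    constructor
    · rintro ⟨w, h1, h2⟩
      have h1' := step_subgraphCompl.1 h1
      have h2' := ih.1 h2
      exact ⟨⟨w, h1'.1, h2'.1⟩, h1'.2, h2'.2⟩
    · rintro ⟨⟨w, h1, h2⟩, h3, h4⟩
      exact ⟨w, step_subgraphCompl.2 ⟨h1, h3⟩, ih.2 ⟨h2, h4⟩⟩

omit [DecidableEq X] in
lemma folded_subgraphCompl (hF : S.Folded) (A : Set X) : (subgraphCompl S A).Folded := by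
  rintro v ⟨⟨e, he⟩, b⟩ h1 ⟨⟨e', he'⟩, b'⟩ h2 h3
  have := @hF v (e, b) h1 (e', b') h2 h3
  simp only [Prod.mk.injEq] at this
  exact Prod.ext (Subtype.ext this.1) this.2

omit [DecidableEq X] in
lemma connected_subgraphCompl (hC : S.Connected) {A : Set X} {v₀ : S.V}
    (hb : ∀ e, S.lab e ∈ A → S.init e = v₀ ∧ S.term e = v₀) :
    (subgraphCompl S A).Connected := by
  refine ⟨hC.1, fun u w => ?_⟩
  have h := adjOn_of_bouquet hC hb u w
  induction h with
  | rel u v h =>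
    obtain ⟨e, he, h⟩ := h
    rcases h with ⟨h1, h2⟩ | ⟨h1, h2⟩
    · exact Relation.EqvGen.rel _ _ ⟨(⟨e, he⟩, true), h1, h2⟩
    · exact Relation.EqvGen.rel _ _ ⟨(⟨e, he⟩, false), h2, h1⟩
  | refl u => exact Relation.EqvGen.refl _
  | symm u v _ ih => exact Relation.EqvGen.symm _ _ ih
  | trans u v w _ _ ih1 ih2 => exact Relation.EqvGen.trans _ _ _ ih1 ih2

lemma loops_subgraphCompl (hF : S.Folded) (A : Set X) (v : S.V) :
    loops (folded_subgraphCompl hF A) v = loops hF v ⊓ FB A := by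
  ext g
  exact rd_subgraphCompl

/-- The group of order two, written multiplicatively. -/
abbrev Sgn := Multiplicative (ZMod 2)

/-- The double cover of `S` defined by a weight on the edges. -/
noncomputable def skew (S : XDigraph X) (f : S.E → Sgn) : XDigraph X :=
  letI : DecidableEq (S.E × Sgn) := Classical.decEq _
  letI : DecidableEq (S.V × Sgn) := Classical.decEq _
  { V := S.V × Sgn
    E := S.E × Sgn
    init := fun e => (S.init e.1, e.2)
    term := fun e => (S.term e.1, e.2 * f e.1)
    lab := fun e => S.lab e.1 }

variable {f : S.E → Sgn}

omit [DecidableEq X] in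
lemma folded_skew (hF : S.Folded) (f : S.E → Sgn) : (skew S f).Folded := by
  rintro ⟨v, y⟩ ⟨⟨e, a⟩, b⟩ h1 ⟨⟨e', a'⟩, b'⟩ h2 h3
  have h3' : (S.lab e, b) = (S.lab e', b') := h3
  simp only [Prod.mk.injEq] at h3'
  obtain ⟨h3a, rfl⟩ := h3'
  have := @hF v (e, b) (by
    cases b
    · exact congrArg Prod.fst h1
    · exact congrArg Prod.fst h1) (e', b) (by
    cases b
    · exact congrArg Prod.fst h2
    · exact congrArg Prod.fst h2) h3
  simp only [Prod.mk.injEq, and_true] at this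
  subst this
  cases b
  · have h4 : a = y := congrArg Prod.snd h1
    have h5 : a' = y := congrArg Prod.snd h2
    rw [h4, h5]
  · have h4 : a * f e = y := congrArg Prod.snd h1
    have h5 : a' * f e = y := congrArg Prod.snd h2
    rw [mul_right_cancel (h4.trans h5.symm)]

omit [DecidableEq X] in
lemma step_skew {u v : S.V} {a b : Sgn} {x : X × Bool}
    (h : Step (skew S f) (u, a) x (v, b)) :
    ∃ e, S.lab e = x.1 ∧ ((x.2 = true ∧ S.init e = u ∧ S.term e = v ∧ b = a * f e) ∨
      (x.2 = false ∧ S.init e = v ∧ S.term e = u ∧ a = b * f e)) := by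
  obtain ⟨⟨⟨e, c⟩, d⟩, h1, h2, h3⟩ := h
  refine ⟨e, by rw [← h2]; rfl, ?_⟩
  cases d
  · right
    have h1' : (S.term e, c * f e) = (u, a) := h1
    have h3' : (S.init e, c) = (v, b) := h3
    simp only [Prod.mk.injEq] at h1' h3'
    exact ⟨by rw [← h2]; rfl, h3'.1, h1'.1, by rw [← h1'.2, h3'.2]⟩
  · left
    have h1' : (S.init e, c) = (u, a) := h1
    have h3' : (S.term e, c * f e) = (v, b) := h3
    simp only [Prod.mk.injEq] at h1' h3'
    exact ⟨by rw [← h2]; rfl, h1'.1, h3'.1, by rw [← h3'.2, h1'.2]⟩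

omit [DecidableEq X] in
lemma exists_step_skew {u v : S.V} {x : X × Bool} (h : Step S u x v) (a : Sgn) :
    ∃ b, Step (skew S f) (u, a) x (v, b) := by
  obtain ⟨⟨e, d⟩, h1, h2, h3⟩ := h
  cases d
  · refine ⟨a * (f e)⁻¹, ((e, a * (f e)⁻¹), false), ?_, h2, ?_⟩
    · change (S.term e, a * (f e)⁻¹ * f e) = (u, a)
      rw [inv_mul_cancel_right, ← h1]; rfl
    · change (S.init e, _) = (v, _)
      rw [← h3]; rfl
  · refine ⟨a * f e, ((e, a), true), ?_, h2, ?_⟩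
    · change (S.init e, a) = (u, a)
      rw [← h1]; rfl
    · change (S.term e, _) = (v, _)
      rw [← h3]; rfl

omit [DecidableEq X] in
lemma exists_rd_skew {u v : S.V} {l : List (X × Bool)} (h : Rd S u l v) (a : Sgn) :
    ∃ b, Rd (skew S f) (u, a) l (v, b) := by
  induction l generalizing u a with
  | nil => exact ⟨a, by rw [show u = v from h]; rfl⟩
  | cons x l ih =>
    obtain ⟨w, h1, h2⟩ := h
    obtain ⟨c, hc⟩ := exists_step_skew (f := f) h1 a
    obtain ⟨b, hb⟩ := ih h2 c
    exact ⟨b, (w, c), hc, hb⟩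

omit [DecidableEq X] in
lemma step_skew_mul {u v : S.V} {a b : Sgn} {x : X × Bool} (c : Sgn)
    (h : Step (skew S f) (u, a) x (v, b)) : Step (skew S f) (u, c * a) x (v, c * b) := by
  obtain ⟨⟨⟨e, k⟩, d⟩, h1, h2, h3⟩ := h
  refine ⟨((e, c * k), d), ?_, h2, ?_⟩
  · cases d
    · have h1' : (S.term e, k * f e) = (u, a) := h1
      simp only [Prod.mk.injEq] at h1'
      change (S.term e, c * k * f e) = (u, c * a)
      rw [h1'.1, mul_assoc, h1'.2]
    · have h1' : (S.init e, k) = (u, a) := h1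
      simp only [Prod.mk.injEq] at h1'
      change (S.init e, c * k) = (u, c * a)
      rw [h1'.1, h1'.2]
  · cases d
    · have h1' : (S.init e, k) = (v, b) := h3
      simp only [Prod.mk.injEq] at h1'
      change (S.init e, c * k) = (v, c * b)
      rw [h1'.1, h1'.2]
    · have h1' : (S.term e, k * f e) = (v, b) := h3
      simp only [Prod.mk.injEq] at h1'
      change (S.term e, c * k * f e) = (v, c * b)
      rw [h1'.1, mul_assoc, h1'.2]

omit [DecidableEq X] in
lemma rd_skew_mul {l : List (X × Bool)} {p q : S.V × Sgn} (c : Sgn)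
    (h : Rd (skew S f) p l q) : Rd (skew S f) (p.1, c * p.2) l (q.1, c * q.2) := by
  induction l generalizing p with
  | nil =>
    have : p = q := h
    subst this; rfl
  | cons x l ih =>
    obtain ⟨w, h1, h2⟩ := h
    exact ⟨(w.1, c * w.2), step_skew_mul c h1, ih h2⟩

lemma pth_skew_unique (hF : S.Folded) {u v : S.V} {a b b' : Sgn} {g : FreeGroup X}
    (h : Pth (skew S f) (u, a) g (v, b)) (h' : Pth (skew S f) (u, a) g (v, b')) : b = b' :=
  congrArg Prod.snd (pth_det (folded_skew hF f) h h')

lemma pth_skew_mul (hF : S.Folded) {u v w : S.V} {a b : Sgn} {g h : FreeGroup X}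
    (h₁ : Pth (skew S f) (u, 1) g (v, a)) (h₂ : Pth (skew S f) (v, 1) h (w, b)) :
    Pth (skew S f) (u, 1) (g * h) (w, a * b) := by
  refine pth_mul (folded_skew hF f) h₁ ?_
  have := rd_skew_mul a h₂
  simpa [Pth] using this

lemma pth_skew_inv {u v : S.V} {a : Sgn} {g : FreeGroup X}
    (h₁ : Pth (skew S f) (u, 1) g (v, a)) : Pth (skew S f) (v, 1) g⁻¹ (u, a⁻¹) := by
  have := rd_skew_mul a⁻¹ (pth_inv h₁)
  simpa [Pth] using this

lemma pth_skew_edge (hF : S.Folded) (e : S.E) :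
    Pth (skew S f) (S.init e, 1) (FreeGroup.mk [(S.lab e, true)]) (S.term e, f e) := by
  have h : Step (skew S f) (S.init e, 1) (S.lab e, true) (S.term e, f e) := by
    refine ⟨((e, 1), true), rfl, rfl, ?_⟩
    change (S.term e, 1 * f e) = _
    rw [one_mul]
  exact pth_mk (folded_skew hF f) (rd_single.2 h)

/-- The total weight of the path labeled `g` from `u` to `v`. -/
noncomputable def weight (f : S.E → Sgn) (u : S.V) (g : FreeGroup X) (v : S.V) : Sgn :=
  open Classical in
  if h : ∃ b, Pth (skew S f) (u, 1) g (v, b) then h.choose else 1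

lemma pth_weight {u v : S.V} {g : FreeGroup X} (h : Pth S u g v) :
    Pth (skew S f) (u, 1) g (v, weight f u g v) := by
  have h' : ∃ b, Pth (skew S f) (u, 1) g (v, b) := exists_rd_skew h 1
  unfold weight
  rw [dif_pos h']
  exact h'.choose_spec

lemma weight_eq (hF : S.Folded) {u v : S.V} {g : FreeGroup X} {b : Sgn} (hp : Pth S u g v)
    (h : Pth (skew S f) (u, 1) g (v, b)) : weight f u g v = b :=
  pth_skew_unique hF (pth_weight hp) h

/-- The character of the loop group defined by a weight on the edges. -/
noncomputable def weightHom (hF : S.Folded) (v : S.V) (f : S.E → Sgn) : loops hF v →* Sgn where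
  toFun g := weight f v g v
  map_one' := weight_eq hF (pth_one v) (pth_one _)
  map_mul' g h := weight_eq hF (pth_mul hF g.2 h.2)
    (pth_skew_mul hF (pth_weight g.2) (pth_weight h.2))

end WhiteheadS

namespace WhiteheadS

variable {X : Type} [DecidableEq X] {S : XDigraph X}

omit [DecidableEq X] in
lemma mk_letter_false (a : X) : FreeGroup.mk [(a, false)] = (FreeGroup.mk [(a, true)])⁻¹ := by
  simp [FreeGroup.inv_mk, FreeGroup.invRev]

/-- Counting mod two cohomology: the loop group has Euler characteristic `|V| - |E|`. -/
theorem card_loops_hom (hF : S.Folded) (hC : S.Connected) (v₀ : S.V) :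
    2 ^ Nat.card S.E * 2 = Nat.card (loops hF v₀ →* Sgn) * 2 ^ Nat.card S.V := by
  obtain ⟨g, hg₀, hg⟩ : ∃ g : S.V → FreeGroup X, g v₀ = 1 ∧ ∀ v, Pth S v₀ (g v) v := by
    choose g hg using fun v => exists_pth hF hC v₀ v
    exact ⟨fun v => (g v₀)⁻¹ * g v, by simp, fun v => pth_mul hF (pth_inv (hg v₀)) (hg v)⟩
  have hkey : ∀ e : S.E, Pth S v₀
      (g (S.init e) * FreeGroup.mk [(S.lab e, true)] * (g (S.term e))⁻¹) v₀ := fun e =>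
    pth_mul hF (pth_mul hF (hg _) (pth_mk hF (rd_single.2 (step_edge e)))) (pth_inv (hg _))
  let k : S.E → loops hF v₀ := fun e => ⟨_, hkey e⟩
  let Φ : (S.E → Sgn) × Sgn → (loops hF v₀ →* Sgn) × (S.V → Sgn) :=
    fun p => (weightHom hF v₀ p.1, fun v => p.2 * weight p.1 v₀ (g v) v)
  have hw₀ : ∀ f, weight f v₀ (g v₀) v₀ = 1 := fun f =>
    weight_eq hF (hg v₀) (by rw [hg₀]; exact pth_one _)
  have hk : ∀ f e, weightHom hF v₀ f (k e) =
      weight f v₀ (g (S.init e)) (S.init e) * f e *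
        (weight f v₀ (g (S.term e)) (S.term e))⁻¹ := fun f e =>
    weight_eq hF (hkey e) (pth_skew_mul hF (pth_skew_mul hF (pth_weight (hg _))
      (pth_skew_edge hF e)) (pth_skew_inv (pth_weight (hg _))))
  have hbij : Function.Bijective Φ := by
    constructor
    · rintro ⟨f, c⟩ ⟨f', c'⟩ h
      simp only [Φ, Prod.mk.injEq] at h
      obtain ⟨h1, h2⟩ := h
      have hc : c = c' := by
        have := congrFun h2 v₀
        simpa [hw₀] using this
      subst hc
      have h3 : ∀ v, weight f v₀ (g v) v = weight f' v₀ (g v) v := fun v =>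
        mul_left_cancel (congrFun h2 v)
      refine Prod.ext (funext fun e => ?_) rfl
      have h4 := hk f e
      rw [h1, hk f' e, h3, h3] at h4
      exact (mul_left_cancel (mul_right_cancel h4)).symm
    · rintro ⟨χ, h⟩
      let f : S.E → Sgn := fun e => (h (S.init e))⁻¹ * χ (k e) * h (S.term e)
      have key : ∀ (l : List (X × Bool)) (v : S.V) (y : Sgn), Rd (skew S f) (v₀, 1) l (v, y) →
          ∃ hm : FreeGroup.mk l * (g v)⁻¹ ∈ loops hF v₀,
            y = (h v₀)⁻¹ * χ ⟨FreeGroup.mk l * (g v)⁻¹, hm⟩ * h v := by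
        intro l
        induction l using List.reverseRecOn with
        | nil =>
          intro v y hr
          have hr' : (v₀, (1 : Sgn)) = (v, y) := hr
          simp only [Prod.mk.injEq] at hr'
          obtain ⟨rfl, rfl⟩ := hr'
          have h1 : FreeGroup.mk [] * (g v₀)⁻¹ = 1 := by
            rw [hg₀, ← FreeGroup.one_eq_mk]; simp
          refine ⟨by rw [h1]; exact one_mem _, ?_⟩
          have : (⟨FreeGroup.mk [] * (g v₀)⁻¹, by rw [h1]; exact one_mem _⟩ :
              loops hF v₀) = 1 := Subtype.ext h1
          rw [this]
          simp
        | append_singleton l x ih =>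
          intro v y hr
          obtain ⟨⟨w, z⟩, h1, h2⟩ := rd_snoc.1 hr
          obtain ⟨hm, hz⟩ := ih w z h1
          obtain ⟨e, he, ⟨hx, rfl, rfl, rfl⟩ | ⟨hx, rfl, rfl, rfl⟩⟩ := step_skew h2
          · have ex : x = (S.lab e, true) := Prod.ext he.symm hx
            have hP : FreeGroup.mk (l ++ [x]) * (g (S.term e))⁻¹ =
                ((⟨_, hm⟩ * k e : loops hF v₀) : FreeGroup X) := by
              simp only [mk_append, ex, k, Subgroup.coe_mul]
              group
            have hm' : FreeGroup.mk (l ++ [x]) * (g (S.term e))⁻¹ ∈ loops hF v₀ := by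
              rw [hP]; exact Subtype.coe_prop _
            refine ⟨hm', ?_⟩
            have : (⟨_, hm'⟩ : loops hF v₀) = ⟨_, hm⟩ * k e := Subtype.ext hP
            rw [this, map_mul, hz]
            simp only [f]
            group
          · have ex : x = (S.lab e, false) := Prod.ext he.symm hx
            have hP : FreeGroup.mk (l ++ [x]) * (g (S.init e))⁻¹ =
                ((⟨_, hm⟩ * (k e)⁻¹ : loops hF v₀) : FreeGroup X) := by
              simp only [mk_append, ex, k, Subgroup.coe_mul, Subgroup.coe_inv, mk_letter_false]
              group
            have hm' : FreeGroup.mk (l ++ [x]) * (g (S.init e))⁻¹ ∈ loops hF v₀ := by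
              rw [hP]; exact Subtype.coe_prop _
            refine ⟨hm', ?_⟩
            have : (⟨_, hm'⟩ : loops hF v₀) = ⟨_, hm⟩ * (k e)⁻¹ := Subtype.ext hP
            rw [this, map_mul, map_inv, eq_mul_inv_of_mul_eq hz]
            simp only [f]
            group
      have key' : ∀ (a : FreeGroup X) (v : S.V) (y : Sgn), Pth (skew S f) (v₀, 1) a (v, y) →
          ∃ hm : a * (g v)⁻¹ ∈ loops hF v₀, y = (h v₀)⁻¹ * χ ⟨a * (g v)⁻¹, hm⟩ * h v := by
        intro a v y hp
        have := key _ _ _ hp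
        simpa only [FreeGroup.mk_toWord] using this
      refine ⟨(f, h v₀), Prod.ext (MonoidHom.ext fun a => ?_) (funext fun v => ?_)⟩
      · obtain ⟨hm, hy⟩ := key' _ _ _ (pth_weight (f := f) a.2)
        have : (⟨a.1 * (g v₀)⁻¹, hm⟩ : loops hF v₀) = a := Subtype.ext (by simp [hg₀])
        rw [this, mul_right_comm, inv_mul_cancel, one_mul] at hy
        exact hy
      · obtain ⟨hm, hy⟩ := key' _ _ _ (pth_weight (f := f) (hg v))
        have : (⟨g v * (g v)⁻¹, hm⟩ : loops hF v₀) = 1 := Subtype.ext (by simp)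
        rw [this, map_one] at hy
        change h v₀ * weight f v₀ (g v) v = h v
        rw [hy]
        simp
  have hcard := Nat.card_congr (Equiv.ofBijective Φ hbij)
  have h2 : Nat.card Sgn = 2 := by
    rw [Nat.card_eq_fintype_card]; rfl
  rw [Nat.card_prod, Nat.card_prod, Nat.card_fun, Nat.card_fun, h2] at hcard
  exact hcard

/-- A subgroup of a free group with exactly two characters of order at most two is cyclic. -/
lemma exists_zpowers_of_card_hom (K : Subgroup (FreeGroup X)) (h : Nat.card (K →* Sgn) = 2) :
    ∃ k, k ≠ 1 ∧ K = Subgroup.zpowers k := by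
  have h1 : Nat.card (IsFreeGroup.Generators K → Sgn) = 2 := by
    rw [← h]
    exact Nat.card_congr IsFreeGroup.lift
  have h2 : Nat.card Sgn = 2 := by
    rw [Nat.card_eq_fintype_card]; rfl
  have : Finite (IsFreeGroup.Generators K → Sgn) := Nat.finite_of_card_ne_zero (by omega)
  have : Finite (IsFreeGroup.Generators K) := by
    classical
    refine Finite.of_injective (β := IsFreeGroup.Generators K → Sgn)
      (fun a b => if b = a then Multiplicative.ofAdd 1 else 1) ?_
    intro a b hab
    by_contra hne
    have := congrFun hab a
    simp only [if_true, if_neg hne] at this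
    revert this
    decide
  rw [Nat.card_fun, h2] at h1
  have h3 : Nat.card (IsFreeGroup.Generators K) = 1 :=
    Nat.pow_right_injective le_rfl (by simpa using h1)
  obtain ⟨hsub, ⟨a⟩⟩ := Nat.card_eq_one_iff_unique.1 h3
  let k : K := IsFreeGroup.of a
  have hgen : ∀ x : K, x ∈ Subgroup.zpowers k := by
    intro x
    have h4 : (Subgroup.zpowers k).subtype.comp
        (IsFreeGroup.lift fun _ => ⟨k, Subgroup.mem_zpowers k⟩) = MonoidHom.id K := by
      apply IsFreeGroup.ext_hom
      intro b
      rw [Subsingleton.elim b a]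
      simp [k]
    have := DFunLike.congr_fun h4 x
    rw [← MonoidHom.id_apply K x, ← this]
    exact Subtype.coe_prop _
  have hK : K = Subgroup.zpowers (k : FreeGroup X) := by
    ext x
    constructor
    · intro hx
      obtain ⟨n, hn⟩ := Subgroup.mem_zpowers_iff.1 (hgen ⟨x, hx⟩)
      exact Subgroup.mem_zpowers_iff.2 ⟨n, by rw [← Subgroup.coe_zpow, hn]⟩
    · intro hx
      exact (Subgroup.zpowers_le.2 k.2) hx
  refine ⟨k, ?_, hK⟩
  intro h1k
  rw [h1k, Subgroup.zpowers_one_eq_bot] at hK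
  have : Nat.card (K →* Sgn) = 1 := by
    rw [Nat.card_eq_one_iff_unique]
    refine ⟨⟨fun φ ψ => MonoidHom.ext fun x => ?_⟩, ⟨1⟩⟩
    have : x = 1 := by
      have hx := hK.le x.2
      rw [Subgroup.mem_bot] at hx
      exact Subtype.ext hx
    rw [this, map_one, map_one]
  omega

end WhiteheadS

namespace WhiteheadS

variable {X : Type} [DecidableEq X] {S : XDigraph X}

lemma card_hom_eq_two_iff (hF : S.Folded) (hC : S.Connected) {A : Set X} {v₀ : S.V}
    (hb : ∀ e, S.lab e ∈ A → S.init e = v₀ ∧ S.term e = v₀) :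
    Nat.card ((loops hF v₀ ⊓ FB A : Subgroup (FreeGroup X)) →* Sgn) = 2 ↔
      Nat.card {e : S.E // S.lab e ∉ A} = Nat.card S.V := by
  have h := card_loops_hom (folded_subgraphCompl hF A) (connected_subgraphCompl hC hb) v₀
  rw [loops_subgraphCompl] at h
  change 2 ^ Nat.card {e : S.E // S.lab e ∉ A} * 2 = _ * 2 ^ Nat.card S.V at h
  constructor
  · intro h2
    rw [h2, mul_comm] at h
    exact Nat.pow_right_injective le_rfl (Nat.eq_of_mul_eq_mul_left two_pos h)
  · intro h2
    rw [h2, mul_comm] at h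
    exact (Nat.eq_of_mul_eq_mul_right (pow_pos two_pos _) h).symm

lemma loops_inf_FB_eq_bot (hF : S.Folded) {A : Set X} (v₀ : S.V)
    (h : ∀ e, S.lab e ∈ A) : loops hF v₀ ⊓ FB A = ⊥ := by
  rw [eq_bot_iff]
  rintro g ⟨h1, h2⟩
  have h1' : Rd S v₀ g.toWord v₀ := h1
  rw [Subgroup.mem_bot, ← FreeGroup.toWord_eq_nil_iff]
  by_contra hne
  obtain ⟨x, l, e⟩ := List.exists_cons_of_ne_nil hne
  rw [e] at h1'
  obtain ⟨w, ⟨d, -, hd, -⟩, -⟩ := h1'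
  refine h2 x (by rw [e]; simp) ?_
  rw [← hd]
  exact h d.1

/-- A folded graph with Property (S): the loop group at the base vertex. -/
lemma PropertyS.loops_structure (hF : S.Folded) {A : Set X} (h : PropertyS S A) :
    ∃ v₀ : S.V, (∃ A' ⊆ A, loops hF v₀ = Subgroup.closure (FreeGroup.of '' A' ∪
        ((loops hF v₀ ⊓ FB A : Subgroup (FreeGroup X)) : Set (FreeGroup X)))) ∧
      (loops hF v₀ ⊓ FB A ≠ ⊥ →
        Nat.card ((loops hF v₀ ⊓ FB A : Subgroup (FreeGroup X)) →* Sgn) = 2) := by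
  obtain ⟨hC, -, ⟨v₀, hb⟩, hcard, -⟩ := h
  refine ⟨v₀, ⟨_, fun x hx => hx.1, loops_eq_closure hF hb⟩, fun hne => ?_⟩
  rw [card_hom_eq_two_iff hF hC hb, hcard]
  have : ∃ e, S.lab e ∉ A := by
    by_contra! hall
    exact hne (loops_inf_FB_eq_bot hF v₀ hall)
  obtain ⟨e₀, he₀⟩ := this
  exact card_touched hC hb he₀

/-- Property (S) can be read off from the loop group at the base vertex. -/
lemma propertyS_of_loops (hF : S.Folded) (hC : S.Connected) (hN : S.NoLeaf) {A A' : Set X}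
    (hA : A' ⊆ A) (u : S.V) (R : Subgroup (FreeGroup X)) (hR : R ≤ FB A)
    (hL : loops hF u = Subgroup.closure (FreeGroup.of '' A' ∪ (R : Set (FreeGroup X))))
    (hcard : R ≠ ⊥ → Nat.card ((loops hF u ⊓ FB A : Subgroup (FreeGroup X)) →* Sgn) = 2) :
    PropertyS S A := by
  have hS : Star A (loops hF u) := by
    rw [hL]; exact star_closure hR
  have hb := bouquet hF hC hN hS
  refine ⟨hC, hN, ⟨u, hb⟩, ?_, fun v w _ _ => adjOn_of_bouquet hC hb v w⟩
  by_cases hE : ∃ e, S.lab e ∉ A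
  · obtain ⟨e, he⟩ := hE
    rw [card_touched hC hb he, ← card_hom_eq_two_iff hF hC hb]
    apply hcard
    rintro rfl
    apply exists_mem_B_letter hF hC hN u he
    rw [hL, Subgroup.closure_le]
    rintro g (⟨a, ha, rfl⟩ | hg)
    · exact mk_mem_FB (l := [(a, true)]) (by simpa using hA ha)
    · rw [SetLike.mem_coe, Subgroup.mem_bot] at hg
      rw [hg]
      exact one_mem _
  · push Not at hE
    have h1 : IsEmpty {e : S.E // S.lab e ∉ A} := ⟨fun e => e.2 (hE _)⟩
    have h2 : IsEmpty {w : S.V // ∃ e : S.E, S.lab e ∉ A ∧ (S.init e = w ∨ S.term e = w)} :=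
      ⟨fun w => by obtain ⟨e, he, -⟩ := w.2; exact he (hE e)⟩
    rw [Nat.card_of_isEmpty, Nat.card_of_isEmpty]

end WhiteheadS

namespace WhiteheadS

variable {X : Type}

/-- A cyclically reduced word conjugate to another one is a rotation of it. -/
lemma isRotated_of_conj [DecidableEq X] {c : FreeGroup X} {l w : List (X × Bool)}
    (hl : FreeGroup.IsCyclicallyReduced l) (hw : FreeGroup.IsCyclicallyReduced w)
    (h : FreeGroup.mk w = c * FreeGroup.mk l * c⁻¹) : w ~r l := by
  revert h
  refine conj_induction (fun c l => FreeGroup.mk w = c * FreeGroup.mk l * c⁻¹ → w ~r l)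
    ?_ ?_ ?_ c l hl
  · intro g h
    rw [← FreeGroup.one_eq_mk, mul_one, mul_inv_cancel, FreeGroup.one_eq_mk] at h
    rw [mk_inj_of hw.1 (by simp) h]
  · intro g l _ hr h
    rw [← mk_invRev, ← mk_append, ← mk_append] at h
    have h1 := mk_inj_of hw.1 hr h
    cases g with
    | nil => simp at h1; rw [h1]
    | cons x g =>
      exfalso
      rw [h1, invRev_cons, cycReduced_iff] at hw
      refine hw.2 (flip x) ?_ x (by simp) (flip_flip x).symm
      rw [← List.append_assoc, List.getLast?_concat]
      simp
  · intro g x l _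
    have e2 : g * FreeGroup.mk (l ++ [x]) * g⁻¹ = g * (FreeGroup.mk [x])⁻¹ *
        FreeGroup.mk (x :: l) * (g * (FreeGroup.mk [x])⁻¹)⁻¹ := by
      rw [mk_append, mk_cons x l]; group
    have e1 : (l ++ [x]) ~r (x :: l) := List.isRotated_append (l := l) (l' := [x])
    rw [e2]
    exact imp_congr_right fun _ => ⟨fun h => h.trans e1, fun h => h.trans e1.symm⟩

/-- The `n`-fold concatenation of a word. -/
def npow (k : List (X × Bool)) : ℕ → List (X × Bool)
  | 0 => []
  | n + 1 => k ++ npow k n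

lemma mk_npow (k : List (X × Bool)) (n : ℕ) :
    FreeGroup.mk (npow k n) = FreeGroup.mk k ^ n := by
  induction n with
  | zero => rfl
  | succ n ih => rw [npow, mk_append, ih, pow_succ']

lemma npow_comm (k : List (X × Bool)) (n : ℕ) : npow k n ++ k = k ++ npow k n := by
  induction n with
  | zero => simp [npow]
  | succ n ih => rw [npow, List.append_assoc, ih]

lemma length_npow (k : List (X × Bool)) (n : ℕ) : (npow k n).length = n * k.length := by
  induction n with
  | zero => simp [npow]
  | succ n ih => simp [npow, ih]; ring

lemma npow_rotate (k : List (X × Bool)) (n : ℕ) :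
    (npow k n).rotate k.length = npow k n := by
  cases n with
  | zero => simp [npow]
  | succ n => rw [npow, List.rotate_append_length_eq, npow_comm]

lemma cycReduced_npow {k : List (X × Bool)} (hk : FreeGroup.IsCyclicallyReduced k) (n : ℕ) :
    FreeGroup.IsCyclicallyReduced (npow k n) := by
  rcases eq_or_ne k [] with rfl | h0
  · have : npow ([] : List (X × Bool)) n = [] := by
      rw [← List.length_eq_zero_iff, length_npow]; simp
    rw [this]; exact hk
  have key : ∀ n, FreeGroup.IsReduced (k ++ npow k n) := by
    intro n
    induction n with
    | zero => simpa [npow] using hk.1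
    | succ n ih =>
      have := isReduced_glue (cycReduced_iff_append_self.1 hk) ih h0
      simpa [npow] using this
  rw [cycReduced_iff_append_self]
  have h2 : npow k n ++ npow k n = npow k (n + n) := by
    generalize n = m at *
    have : ∀ a b, npow k a ++ npow k b = npow k (a + b) := by
      intro a b
      induction a with
      | zero => simp [npow]
      | succ a ih => rw [Nat.succ_add, npow, List.append_assoc, ih]; rfl
    exact this _ _
  rw [h2]
  exact isReduced_right (key _)

lemma cycReduced_invRev {k : List (X × Bool)} (hk : FreeGroup.IsCyclicallyReduced k) :
    FreeGroup.IsCyclicallyReduced (FreeGroup.invRev k) := by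
  rw [cycReduced_iff_append_self] at hk ⊢
  rw [← FreeGroup.invRev_append]
  exact isReduced_invRev hk

lemma mem_zpowers_of_comm {k : List (X × Bool)} : ∀ (j : ℕ) (g : List (X × Bool)),
    g.length = j * k.length → k ++ g = g ++ k →
    FreeGroup.mk g ∈ Subgroup.zpowers (FreeGroup.mk k) := by
  intro j
  induction j with
  | zero =>
    intro g h _
    simp at h
    rw [h, ← FreeGroup.one_eq_mk]
    exact one_mem _
  | succ j ih =>
    intro g h e
    have hp : k <+: g := by
      have h1 : k <+: g ++ k := e ▸ List.prefix_append k g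
      refine List.prefix_of_prefix_length_le h1 (List.prefix_append g k) ?_
      rw [h]; nlinarith
    obtain ⟨g', rfl⟩ := hp
    rw [mk_append]
    refine mul_mem (Subgroup.mem_zpowers _) (ih g' ?_ ?_)
    · simp at h; linarith
    · rw [List.append_assoc] at e
      exact List.append_cancel_left e

variable [DecidableEq X]

lemma period_of_conj {k w : List (X × Bool)} (hk : FreeGroup.IsCyclicallyReduced k)
    (hw : FreeGroup.IsCyclicallyReduced w)
    (h : ConjInto (Subgroup.zpowers (FreeGroup.mk k)) (FreeGroup.mk w)) :
    w.rotate k.length = w ∧ k.length ∣ w.length := by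
  have key : ∀ (k : List (X × Bool)), FreeGroup.IsCyclicallyReduced k → ∀ (n : ℕ) c,
      c * FreeGroup.mk w * c⁻¹ = FreeGroup.mk k ^ n →
      w.rotate k.length = w ∧ k.length ∣ w.length := by
    intro k hk n c e
    have e' : FreeGroup.mk w = c⁻¹ * FreeGroup.mk (npow k n) * c⁻¹⁻¹ := by
      rw [mk_npow, ← e]; group
    obtain ⟨r, hr⟩ := (isRotated_of_conj (cycReduced_npow hk n) hw e').symm
    constructor
    · rw [← hr, List.rotate_rotate, add_comm, ← List.rotate_rotate, npow_rotate]
    · rw [← hr, List.length_rotate, length_npow]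
      exact dvd_mul_left _ _
  obtain ⟨c, h⟩ := h
  obtain ⟨n, hn⟩ := Subgroup.mem_zpowers_iff.1 h
  obtain ⟨n, rfl | rfl⟩ := n.eq_nat_or_neg
  · exact key k hk n c (by rw [← hn, zpow_natCast])
  · have := key (FreeGroup.invRev k) (cycReduced_invRev hk) n c (by
      rw [← hn, mk_invRev, zpow_neg, zpow_natCast, inv_pow])
    simpa using this

lemma mem_zpowers_of_reduced {k g : List (X × Bool)} (hk : FreeGroup.IsCyclicallyReduced k)
    (hk0 : k ≠ []) (h1 : FreeGroup.IsReduced (g ++ k)) (h2 : FreeGroup.IsReduced (k ++ g))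
    (h : ConjInto (Subgroup.zpowers (FreeGroup.mk k)) (FreeGroup.mk g * FreeGroup.mk k)) :
    FreeGroup.mk g ∈ Subgroup.zpowers (FreeGroup.mk k) := by
  rcases eq_or_ne g [] with rfl | hg
  · rw [← FreeGroup.one_eq_mk]; exact one_mem _
  rw [← mk_append] at h
  have hw : FreeGroup.IsCyclicallyReduced (g ++ k) := by
    rw [cycReduced_iff_append_self]
    have := isReduced_glue (isReduced_glue h1 h2 hk0) (by simpa using h1) hg
    simpa using this
  obtain ⟨h3, h4⟩ := period_of_conj hk hw h
  have h5 : k ++ g = g ++ k := by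
    apply List.rotate_injective k.length
    simp only [h3]
    exact List.rotate_append_length_eq k g
  have h6 : k.length ∣ g.length := by
    rw [List.length_append] at h4
    exact (Nat.dvd_add_left (dvd_refl _)).1 h4
  obtain ⟨j, hj⟩ := h6
  exact mem_zpowers_of_comm j g (by rw [hj, mul_comm]) h5

lemma conjInto_zpowers_conj {G : Type*} [Group G] {k x : G} (c : G)
    (h : ConjInto (Subgroup.zpowers k) x) :
    ConjInto (Subgroup.zpowers (c * k * c⁻¹)) (c * x * c⁻¹) := by
  obtain ⟨d, hd⟩ := h
  obtain ⟨n, hn⟩ := Subgroup.mem_zpowers_iff.1 hd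
  refine ⟨c * d * c⁻¹, Subgroup.mem_zpowers_iff.2 ⟨n, ?_⟩⟩
  rw [conj_zpow, hn]
  group

/-- If `g k` and `g k⁻¹` are conjugate to powers of `k`, then `g` is a power of `k`. -/
lemma mem_zpowers_of_conj (n : ℕ) : ∀ (k g : List (X × Bool)), g.length ≤ n →
    FreeGroup.IsCyclicallyReduced k → k ≠ [] → FreeGroup.IsReduced g →
    ConjInto (Subgroup.zpowers (FreeGroup.mk k)) (FreeGroup.mk g * FreeGroup.mk k) →
    ConjInto (Subgroup.zpowers (FreeGroup.mk k)) (FreeGroup.mk g * (FreeGroup.mk k)⁻¹) →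
    FreeGroup.mk g ∈ Subgroup.zpowers (FreeGroup.mk k) := by
  induction n with
  | zero =>
    intro k g hg _ _ _ _ _
    simp at hg
    rw [hg, ← FreeGroup.one_eq_mk]; exact one_mem _
  | succ n ih =>
    intro k g hlen hk hk0 hg h1 h2
    by_cases ha : FreeGroup.IsReduced (g ++ k) ∧ FreeGroup.IsReduced (k ++ g)
    · exact mem_zpowers_of_reduced hk hk0 ha.1 ha.2 h1
    by_cases hb : FreeGroup.IsReduced (g ++ FreeGroup.invRev k) ∧
        FreeGroup.IsReduced (FreeGroup.invRev k ++ g)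
    · have := mem_zpowers_of_reduced (cycReduced_invRev hk) (by
        intro h0; apply hk0
        have := congrArg List.length h0
        simpa using this) hb.1 hb.2 (by
        rw [mk_invRev, Subgroup.zpowers_inv]; exact h2)
      rwa [mk_invRev, Subgroup.zpowers_inv] at this
    obtain ⟨p, k₁, rfl⟩ := List.exists_cons_of_ne_nil hk0
    obtain ⟨k₂, q, e⟩ : ∃ t' z, p :: k₁ = t' ++ [z] := by
      rcases List.eq_nil_or_concat (p :: k₁) with e | ⟨t', z, e⟩
      · simp at e
      · exact ⟨t', z, by rw [e, List.concat_eq_append]⟩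
    have hpq : p ≠ flip q := by
      have h3 := (cycReduced_iff.1 hk).2 q (by rw [e]; simp) p (by simp)
      exact h3
    have step : ∀ (x : X × Bool) (g₁ k' : List (X × Bool)), g = x :: (g₁ ++ [flip x]) →
        FreeGroup.IsCyclicallyReduced k' → k' ≠ [] →
        FreeGroup.mk (p :: k₁) = FreeGroup.mk [x] * FreeGroup.mk k' * (FreeGroup.mk [x])⁻¹ →
        FreeGroup.mk g ∈ Subgroup.zpowers (FreeGroup.mk (p :: k₁)) := by
      intro x g₁ k' eg hk' hk0' ek
      have eg' : FreeGroup.mk g = FreeGroup.mk [x] * FreeGroup.mk g₁ * (FreeGroup.mk [x])⁻¹ := by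
        rw [eg, mk_cons, mk_append, mk_flip]; group
      have h1' := conjInto_zpowers_conj (FreeGroup.mk [x])⁻¹ h1
      have h2' := conjInto_zpowers_conj (FreeGroup.mk [x])⁻¹ h2
      rw [ek, eg'] at h1' h2'
      have e3 : (FreeGroup.mk [x])⁻¹ * (FreeGroup.mk [x] * FreeGroup.mk k' *
          (FreeGroup.mk [x])⁻¹) * ((FreeGroup.mk [x])⁻¹)⁻¹ = FreeGroup.mk k' := by group
      have e4 : (FreeGroup.mk [x])⁻¹ * (FreeGroup.mk [x] * FreeGroup.mk g₁ *
          (FreeGroup.mk [x])⁻¹ * (FreeGroup.mk [x] * FreeGroup.mk k' *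
          (FreeGroup.mk [x])⁻¹)) * ((FreeGroup.mk [x])⁻¹)⁻¹ =
          FreeGroup.mk g₁ * FreeGroup.mk k' := by group
      have e5 : (FreeGroup.mk [x])⁻¹ * (FreeGroup.mk [x] * FreeGroup.mk g₁ *
          (FreeGroup.mk [x])⁻¹ * (FreeGroup.mk [x] * FreeGroup.mk k' *
          (FreeGroup.mk [x])⁻¹)⁻¹) * ((FreeGroup.mk [x])⁻¹)⁻¹ =
          FreeGroup.mk g₁ * (FreeGroup.mk k')⁻¹ := by group
      rw [e3, e4] at h1'
      rw [e3, e5] at h2'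
      have hg₁ : FreeGroup.IsReduced g₁ := by
        rw [eg] at hg
        exact isReduced_left (isReduced_right (l := [x]) hg)
      have := ih k' g₁ (by rw [eg] at hlen; simp at hlen; omega) hk' hk0' hg₁ h1' h2'
      obtain ⟨i, hi⟩ := Subgroup.mem_zpowers_iff.1 this
      refine Subgroup.mem_zpowers_iff.2 ⟨i, ?_⟩
      rw [ek, eg', conj_zpow, hi]
    rcases List.eq_nil_or_concat g with rfl | ⟨g₃, b, eb⟩
    · rw [← FreeGroup.one_eq_mk]; exact one_mem _
    rw [List.concat_eq_append] at eb
    obtain ⟨a, g₂, ea⟩ : ∃ a g₂, g = a :: g₂ :=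
      List.exists_cons_of_ne_nil (by rw [eb]; simp)
    have peel : ∀ x, a = x → b = flip x → ∃ g₁, g = x :: (g₁ ++ [flip x]) := by
      rintro x rfl rfl
      rw [ea] at eb
      cases g₃ with
      | nil =>
        simp at eb
        exact absurd eb.1.symm (flip_ne a)
      | cons y g₃ =>
        simp at eb
        exact ⟨g₃, by rw [ea, eb.2]⟩
    have ha' : p = flip b ∨ a = flip q := by
      by_contra! hc
      apply ha
      rw [isReduced_append, isReduced_append]
      refine ⟨⟨hg, hk.1, ?_⟩, hk.1, hg, ?_⟩
      · rw [eb]; simpa using hc.1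
      · rw [e, ea]; simpa using hc.2
    have hb' : q = b ∨ a = p := by
      by_contra! hc
      apply hb
      rw [isReduced_append, isReduced_append]
      refine ⟨⟨hg, isReduced_invRev hk.1, ?_⟩, isReduced_invRev hk.1, hg, ?_⟩
      · rw [eb, e, invRev_snoc]
        simp only [List.getLast?_concat, List.head?_cons, Option.mem_some_iff]
        rintro _ rfl _ rfl hh
        have := congrArg flip hh
        simp only [flip_flip] at this
        exact hc.1 this
      · rw [invRev_cons, ea]
        simp only [List.getLast?_concat, List.head?_cons, Option.mem_some_iff]
        rintro _ rfl _ rfl hh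
        rw [flip_flip] at hh
        exact hc.2 hh
    rcases ha' with h3 | h3 <;> rcases hb' with h4 | h4
    · exact absurd (h4 ▸ h3) hpq
    · obtain ⟨g₁, eg⟩ := peel p h4 (by rw [h3, flip_flip])
      refine step p g₁ (k₁ ++ [p]) eg (cycReduced_comm (l := [p]) hk) (by simp) ?_
      rw [mk_cons, mk_append]; group
    · obtain ⟨g₁, eg⟩ := peel (flip q) h3 (by rw [flip_flip, h4])
      refine step (flip q) g₁ (q :: k₂) eg (cycReduced_comm (r := [q]) (e ▸ hk)) (by simp) ?_
      rw [e, mk_cons q, mk_append, mk_flip]; group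
    · exact absurd (h4.symm.trans h3) hpq

end WhiteheadS

namespace WhiteheadS

variable {X : Type} [DecidableEq X]

/-- A subgroup all of whose elements are conjugate to powers of its cyclically reduced
element `k` is generated by `k`. -/
lemma eq_zpowers_of_conjInto {L : Subgroup (FreeGroup X)} {k : List (X × Bool)}
    (hk : FreeGroup.IsCyclicallyReduced k) (hk0 : k ≠ []) (hkL : FreeGroup.mk k ∈ L)
    (h : ∀ g ∈ L, ConjInto (Subgroup.zpowers (FreeGroup.mk k)) g) :
    L = Subgroup.zpowers (FreeGroup.mk k) := by
  refine le_antisymm (fun g hg => ?_) (by rwa [Subgroup.zpowers_le])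
  have := mem_zpowers_of_conj _ k g.toWord le_rfl hk hk0 FreeGroup.isReduced_toWord
    (h _ (by rw [FreeGroup.mk_toWord]; exact L.mul_mem hg hkL))
    (h _ (by rw [FreeGroup.mk_toWord]; exact L.mul_mem hg (L.inv_mem hkL)))
  rwa [FreeGroup.mk_toWord] at this

lemma conjInto_zpowers_of_conj {G : Type*} [Group G] {k g : G} (c : G) :
    ConjInto (Subgroup.zpowers (c * k * c⁻¹)) g ↔ ConjInto (Subgroup.zpowers k) g := by
  constructor
  · intro h
    have := conjInto_zpowers_conj c⁻¹ h
    rw [conjInto_conj] at this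
    simpa [mul_assoc] using this
  · intro h
    have := conjInto_zpowers_conj c h
    rwa [conjInto_conj] at this

lemma FB_eq_closure (A : Set X) : FB A = Subgroup.closure (FreeGroup.of '' Aᶜ) := by
  apply le_antisymm
  · intro g hg
    refine FB_induction (fun g => g ∈ Subgroup.closure (FreeGroup.of '' Aᶜ)) (one_mem _) ?_ g hg
    intro x l hx h
    rw [mk_append]
    exact mul_mem h ((mk_single_mem_iff x).2 (Subgroup.subset_closure ⟨x.1, hx, rfl⟩))
  · rw [Subgroup.closure_le]
    rintro _ ⟨x, hx, rfl⟩
    exact mk_mem_FB (l := [(x, true)]) (by simpa using hx)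

/-- An uncut Whitehead automorphism, up to an inner automorphism, fixes the `A`-letters and
preserves the free factor of words without `A`-letters. -/
lemma exists_normalised {A : Set X} {phi : FreeGroup X ≃* FreeGroup X} {C : Finset (X × Bool)}
    {m : X × Bool} (hphi : IsWhiteheadII phi C m) (hm : m.1 ∉ A)
    (hcut : (∀ x ∈ A, (x, true) ∈ C ∧ (x, false) ∈ C) ∨
            (∀ x ∈ A, (x, true) ∉ C ∧ (x, false) ∉ C)) :
    ∃ (psi : FreeGroup X ≃* FreeGroup X) (c : FreeGroup X),
      (∀ g, psi g = c * phi g * c⁻¹) ∧ (∀ a ∈ A, psi (FreeGroup.of a) = FreeGroup.of a) ∧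
      (FB A).map psi.toMonoidHom = FB A := by
  have hne : ∀ a ∈ A, a ≠ m.1 := fun a ha e => hm (e ▸ ha)
  have key : ∀ (psi : FreeGroup X ≃* FreeGroup X) (c : FreeGroup X), (c = 1 ∨ c = iota m) →
      (∀ g, psi g = c * phi g * c⁻¹) → (FB A).map psi.toMonoidHom = FB A := by
    intro psi c hc h
    have hio : ∀ M : Subgroup (FreeGroup X), FreeGroup.of m.1 ∈ M → iota m ∈ M := by
      intro M hM
      unfold iota
      split_ifs
      · exact hM
      · exact inv_mem hM
    have hcM : ∀ M : Subgroup (FreeGroup X), FreeGroup.of m.1 ∈ M → c ∈ M := by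
      rintro M hM
      rcases hc with rfl | rfl
      · exact one_mem _
      · exact hio M hM
    have hpm : psi (FreeGroup.of m.1) = FreeGroup.of m.1 := by
      rw [h, hphi.2.2, if_pos rfl]
      rcases hc with rfl | rfl
      · simp
      · unfold iota
        split_ifs <;> group
    have hofm : FreeGroup.of m.1 ∈ FB A := by
      rw [FB_eq_closure]; exact Subgroup.subset_closure ⟨_, hm, rfl⟩
    have hall : ∀ M : Subgroup (FreeGroup X), FreeGroup.of m.1 ∈ M → ∀ x,
        psi (FreeGroup.of x) ∈ M ↔ FreeGroup.of x ∈ M := by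
      intro M hM x
      rw [h, hphi.2.2]
      rw [Subgroup.mul_mem_cancel_right _ (inv_mem (hcM M hM)),
        Subgroup.mul_mem_cancel_left _ (hcM M hM)]
      split_ifs <;>
        simp [Subgroup.mul_mem_cancel_right, Subgroup.mul_mem_cancel_left, hio M hM]
    apply le_antisymm
    · rw [Subgroup.map_le_iff_le_comap]
      conv_lhs => rw [FB_eq_closure]
      rw [Subgroup.closure_le]
      rintro _ ⟨x, hx, rfl⟩
      refine (hall _ hofm x).2 ?_
      rw [FB_eq_closure]; exact Subgroup.subset_closure ⟨_, hx, rfl⟩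
    · conv_lhs => rw [FB_eq_closure]
      rw [Subgroup.closure_le]
      rintro _ ⟨x, hx, rfl⟩
      refine (hall ((FB A).map psi.toMonoidHom) ⟨_, hofm, hpm⟩ x).1 ⟨_, ?_, rfl⟩
      rw [FB_eq_closure]; exact Subgroup.subset_closure ⟨_, hx, rfl⟩
  rcases hcut with hcut | hcut
  · refine ⟨phi.trans (MulAut.conj (iota m)), iota m, fun g => rfl, ?_,
      key _ _ (Or.inr rfl) fun g => rfl⟩
    intro a ha
    change iota m * phi _ * (iota m)⁻¹ = _
    rw [hphi.2.2, if_neg (hne a ha), if_pos (hcut a ha).1, if_pos (hcut a ha).2]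
    group
  · refine ⟨phi, 1, by simp, ?_, key _ _ (Or.inl rfl) (by simp)⟩
    intro a ha
    rw [hphi.2.2, if_neg (hne a ha), if_neg (hcut a ha).1, if_neg (hcut a ha).2]
    simp

/-- The properties of the fundamental group of `T` carried over by the automorphism. -/
lemma exists_model {T T' : XDigraph X} {H : Subgroup (FreeGroup X)} {A : Set X}
    (hT : CRep T H) (hPS : PropertyS T A) {phi : FreeGroup X ≃* FreeGroup X}
    {C : Finset (X × Bool)} {m : X × Bool} (hphi : IsWhiteheadII phi C m) (hm : m.1 ∉ A)
    (hcut : (∀ x ∈ A, (x, true) ∈ C ∧ (x, false) ∈ C) ∨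
            (∀ x ∈ A, (x, true) ∉ C ∧ (x, false) ∉ C))
    (hT' : CRep T' (H.map phi.toMonoidHom)) :
    ∃ (A' : Set X) (K : Subgroup (FreeGroup X)), A' ⊆ A ∧
      K = Subgroup.closure (FreeGroup.of '' A' ∪ ↑(K ⊓ FB A)) ∧
      (K ⊓ FB A ≠ ⊥ → Nat.card (↥(K ⊓ FB A) →* Sgn) = 2) ∧
      ∀ u g, ConjInto (loops hT'.1 u) g ↔ ConjInto K g := by
  obtain ⟨v, ⟨A', hA', hgen⟩, hcard⟩ := PropertyS.loops_structure hT.1 hPS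
  obtain ⟨psi, c, hpsi, hfix, hFB⟩ := exists_normalised hphi hm hcut
  set K := loops hT.1 v with hK
  have hinj : Function.Injective psi.toMonoidHom := psi.injective
  have hinf : K.map psi.toMonoidHom ⊓ FB A = (K ⊓ FB A).map psi.toMonoidHom := by
    conv_lhs => rw [← hFB]
    rw [Subgroup.map_inf _ _ _ hinj]
  refine ⟨A', K.map psi.toMonoidHom, hA', ?_, ?_, ?_⟩
  · rw [hinf]
    conv_lhs => rw [hgen]
    rw [MonoidHom.map_closure, Set.image_union, Subgroup.coe_map]
    congr 2
    rw [Set.image_image]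
    exact Set.image_congr fun a ha => hfix a (hA' ha)
  · rw [hinf]
    intro h
    refine Eq.trans ?_ (hcard (by rintro h0; exact h (by rw [h0, Subgroup.map_bot])))
    exact (Nat.card_congr
      ((Subgroup.equivMapOfInjective (K ⊓ FB A) psi.toMonoidHom hinj).monoidHomCongrLeftEquiv)).symm
  · intro u g
    rw [crep_conjInto_iff hT' u]
    have e1 : ConjInto (H.map phi.toMonoidHom) g ↔ ConjInto H (phi.symm g) := by
      constructor
      · rintro ⟨d, h, hh, e⟩
        refine ⟨phi.symm d, ?_⟩
        have : phi.symm d * phi.symm g * (phi.symm d)⁻¹ = h := by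
          apply phi.injective
          simpa using e.symm
        rwa [this]
      · rintro ⟨d, hd⟩
        exact ⟨phi d, _, hd, by simp⟩
    have e2 : ConjInto (K.map psi.toMonoidHom) g ↔ ConjInto K (phi.symm g) := by
      have hps : ∀ x, psi x = c * phi x * c⁻¹ := hpsi
      constructor
      · rintro ⟨d, h, hh, e⟩
        refine ⟨phi.symm (c⁻¹ * d), ?_⟩
        have : phi.symm (c⁻¹ * d) * phi.symm g * (phi.symm (c⁻¹ * d))⁻¹ = h := by
          apply psi.injective
          rw [hps, ← map_inv phi.symm, ← map_mul, ← map_mul, MulEquiv.apply_symm_apply]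
          refine Eq.trans ?_ e.symm
          group
        rwa [this]
      · rintro ⟨d, hd⟩
        refine ⟨c * phi d, _, hd, ?_⟩
        change psi _ = _
        rw [hps]
        simp [mul_assoc]
    rw [e1, e2, hK, crep_conjInto_iff hT v]

end WhiteheadS

namespace WhiteheadS

variable {X : Type} [DecidableEq X] {S : XDigraph X} {A A' : Set X}
  {K : Subgroup (FreeGroup X)}

/-- The case in which the loop groups are conjugate to a cyclic group generated by a
cyclically reduced word. -/
lemma exists_loops_eq_zpowers (hF : S.Folded) (hC : S.Connected)
    (hK : ∀ u g, ConjInto (loops hF u) g ↔ ConjInto K g) {k : List (X × Bool)}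
    (hk : FreeGroup.IsCyclicallyReduced k) (hk0 : k ≠ []) (hkK : ConjInto K (FreeGroup.mk k))
    (h : ∀ g ∈ K, ConjInto (Subgroup.zpowers (FreeGroup.mk k)) g) :
    ∃ u, loops hF u = Subgroup.zpowers (FreeGroup.mk k) := by
  obtain ⟨v⟩ := hC.1
  obtain ⟨u, hu⟩ := (conjInto_loops_iff hF hC v hk).1 ((hK v _).2 hkK)
  refine ⟨u, eq_zpowers_of_conjInto hk hk0 (pth_mk hF hu) fun g hg => ?_⟩
  obtain ⟨c, hc⟩ := (hK u g).1 ⟨1, by simpa using hg⟩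
  exact (conjInto_conj c).1 (h _ hc)

lemma propertyS_of_cyclic (hF : S.Folded) (hC : S.Connected) (hN : S.NoLeaf)
    (hK : ∀ u g, ConjInto (loops hF u) g ↔ ConjInto K g) (hKB : K ≤ FB A)
    (hcard : K ⊓ FB A ≠ ⊥ → Nat.card (↥(K ⊓ FB A) →* Sgn) = 2) : PropertyS S A := by
  rw [inf_of_le_left hKB] at hcard
  by_cases hbot : K = ⊥
  · obtain ⟨u⟩ := hC.1
    refine propertyS_of_loops hF hC hN (Set.empty_subset A) u ⊥ bot_le ?_ (absurd rfl)
    simp only [Set.image_empty, Set.empty_union, Subgroup.closure_eq]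
    rw [eq_bot_iff]
    intro g hg
    obtain ⟨c, hc⟩ := (hK u g).1 ⟨1, by simpa using hg⟩
    rw [hbot, Subgroup.mem_bot] at hc
    simpa using hc
  · have h2 := hcard hbot
    obtain ⟨k, hk1, hk⟩ := exists_zpowers_of_card_hom K h2
    obtain ⟨p, w, hw, hr, rfl⟩ := exists_conj_form k
    have ek : FreeGroup.mk (p ++ w ++ FreeGroup.invRev p) =
        FreeGroup.mk p * FreeGroup.mk w * (FreeGroup.mk p)⁻¹ := by
      rw [mk_append, mk_append, mk_invRev]
    have hw0 : w ≠ [] := by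
      rintro rfl
      apply hk1
      rw [ek, ← FreeGroup.one_eq_mk]; group
    have hwB : FreeGroup.mk w ∈ FB A := by
      apply mk_mem_FB
      intro x hx
      refine letters_of_mem_FB hr (hKB ?_) x (by simp [hx])
      rw [hk]; exact Subgroup.mem_zpowers _
    obtain ⟨u, hu⟩ := exists_loops_eq_zpowers hF hC hK hw hw0
      ⟨FreeGroup.mk p, by rw [← ek, hk]; exact Subgroup.mem_zpowers _⟩ (fun g hg => by
        rw [← conjInto_zpowers_of_conj (FreeGroup.mk p), ← ek, ← hk]
        exact ⟨1, by simpa using hg⟩)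
    have hle : loops hF u ≤ FB A := by rw [hu, Subgroup.zpowers_le]; exact hwB
    refine propertyS_of_loops hF hC hN (Set.empty_subset A) u (loops hF u) hle ?_ fun _ => ?_
    · simp [Subgroup.closure_eq]
    · rw [inf_of_le_left hle]
      have e : (loops hF u).map (MulAut.conj (FreeGroup.mk p)).toMonoidHom = K := by
        rw [hu, MonoidHom.map_zpowers, hk, ek]; rfl
      refine Eq.trans ?_ h2
      rw [← e]
      exact Nat.card_congr (Subgroup.equivMapOfInjective _ _
        (MulAut.conj (FreeGroup.mk p)).injective).monoidHomCongrLeftEquiv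

lemma propertyS_of_letter (hF : S.Folded) (hC : S.Connected) (hN : S.NoLeaf)
    (hK : ∀ u g, ConjInto (loops hF u) g ↔ ConjInto K g) {a : X} (ha : a ∈ A)
    (haK : FreeGroup.of a ∈ K) (hle : K ≤ Subgroup.zpowers (FreeGroup.of a)) :
    PropertyS S A := by
  obtain ⟨u, hu⟩ := exists_loops_eq_zpowers hF hC hK (k := [(a, true)])
    (by rw [cycReduced_iff_append_self]; simp [FreeGroup.IsReduced]) (by simp)
    ⟨1, by simpa using (show FreeGroup.mk [(a, true)] ∈ K from haK)⟩
    (fun g hg => ⟨1, by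
      simpa using (show g ∈ Subgroup.zpowers (FreeGroup.mk [(a, true)]) from hle hg)⟩)
  refine propertyS_of_loops hF hC hN (A' := {a}) (by simpa using ha) u ⊥ bot_le ?_ (absurd rfl)
  rw [hu, Set.image_singleton, Subgroup.closure_union, Subgroup.closure_eq, sup_bot_eq,
    Subgroup.zpowers_eq_closure]
  rfl

end WhiteheadS

namespace WhiteheadS

/-- A transitive action of a finite group on a finite set in which every element has a fixed
point is an action on a single point. -/
lemma subsingleton_of_forall_fixed {G α : Type*} [Group G] [Finite G] [Finite α] [MulAction G α]
    [MulAction.IsPretransitive G α] (h : ∀ g : G, ∃ x : α, g • x = x) : Subsingleton α := by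
  classical
  have := Fintype.ofFinite G
  have := Fintype.ofFinite α
  have hb := MulAction.sum_card_fixedBy_eq_card_orbits_mul_card_group G α
  have h1 : Fintype.card (Quotient (MulAction.orbitRel G α)) ≤ 1 := by
    rw [Fintype.card_le_one_iff_subsingleton]
    exact MulAction.pretransitive_iff_subsingleton_quotient G α |>.1 inferInstance
  by_contra hne
  rw [← Fintype.card_le_one_iff_subsingleton, not_le] at hne
  have h2 : ∑ _g : G, 1 < ∑ g : G, Fintype.card (MulAction.fixedBy α g) := by
    apply Finset.sum_lt_sum
    · intro g _
      obtain ⟨x, hx⟩ := h g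
      exact Fintype.card_pos_iff.2 ⟨⟨x, hx⟩⟩
    · refine ⟨1, Finset.mem_univ _, ?_⟩
      refine hne.trans_eq (Fintype.card_congr ?_)
      exact (Equiv.subtypeUnivEquiv (fun x => one_smul G x)).symm
  rw [hb] at h2
  simp at h2
  nlinarith

variable {X : Type} [DecidableEq X] {S : XDigraph X} {A : Set X}
  {K : Subgroup (FreeGroup X)} {a : X}

/-- A subgroup containing `a` properly more than powers of `a` contains a nonempty reduced word
neither starting nor ending with `a` or `a⁻¹`. -/
lemma exists_trimmed (haK : FreeGroup.of a ∈ K) (hne : ¬ K ≤ Subgroup.zpowers (FreeGroup.of a)) :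
    ∃ h : List (X × Bool), FreeGroup.IsReduced h ∧ FreeGroup.mk h ∈ K ∧ h ≠ [] ∧
      (∀ x ∈ h.head?, x.1 ≠ a) ∧ ∀ x ∈ h.getLast?, x.1 ≠ a := by
  have hex : ∃ n, ∃ h : List (X × Bool), h.length = n ∧ FreeGroup.IsReduced h ∧
      FreeGroup.mk h ∈ K ∧ FreeGroup.mk h ∉ Subgroup.zpowers (FreeGroup.of a) := by
    rw [SetLike.not_le_iff_exists] at hne
    obtain ⟨g, hg, hg'⟩ := hne
    exact ⟨_, g.toWord, rfl, FreeGroup.isReduced_toWord, by rwa [FreeGroup.mk_toWord],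
      by rwa [FreeGroup.mk_toWord]⟩
  classical
  obtain ⟨h, hlen, hr, hK, hz⟩ := Nat.find_spec hex
  have hmin := fun {n} hn => @Nat.find_min _ _ hex n hn
  rw [← hlen] at hmin
  have haz : ∀ x : X × Bool, x.1 = a → FreeGroup.mk [x] ∈ K ∧
      FreeGroup.mk [x] ∈ Subgroup.zpowers (FreeGroup.of a) := by
    rintro x rfl
    exact ⟨(mk_single_mem_iff x).2 haK, (mk_single_mem_iff x).2 (Subgroup.mem_zpowers _)⟩
  refine ⟨h, hr, hK, ?_, ?_, ?_⟩
  · rintro rfl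
    rw [← FreeGroup.one_eq_mk] at hz
    exact hz (one_mem _)
  · intro x hx hxa
    obtain ⟨t, rfl⟩ : ∃ t, h = x :: t := by
      cases h with
      | nil => simp at hx
      | cons y t => simp at hx; exact ⟨t, by rw [hx]⟩
    rw [mk_cons, Subgroup.mul_mem_cancel_left _ (haz x hxa).1] at hK
    rw [mk_cons, Subgroup.mul_mem_cancel_left _ (haz x hxa).2] at hz
    exact hmin (n := t.length) (by simp) ⟨t, rfl, isReduced_right (l := [x]) hr, hK, hz⟩
  · intro x hx hxa
    obtain ⟨t, rfl⟩ := List.mem_getLast?_eq_getLast hx |>.elim fun hne e => 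
      (⟨h.dropLast, by rw [e, List.dropLast_append_getLast]⟩ : ∃ t, h = t ++ [x])
    rw [mk_append, Subgroup.mul_mem_cancel_right _ (haz x hxa).1] at hK
    rw [mk_append, Subgroup.mul_mem_cancel_right _ (haz x hxa).2] at hz
    exact hmin (n := t.length) (by simp) ⟨t, rfl, isReduced_left hr, hK, hz⟩

/-- Reduced words of `K` starting with `a` and not ending with `a` or `a⁻¹`. -/
structure Framed (K : Subgroup (FreeGroup X)) (a : X) (l : List (X × Bool)) : Prop where
  red : FreeGroup.IsReduced l
  mem : FreeGroup.mk l ∈ K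
  head : ∃ t, l = (a, true) :: t
  last : ∀ x ∈ l.getLast?, x.1 ≠ a

lemma framed_junction {l r : List (X × Bool)} (hl : FreeGroup.IsReduced l)
    (hr : FreeGroup.IsReduced r) (h1 : ∀ x ∈ l.getLast?, x.1 ≠ a)
    (h2 : ∀ x ∈ r.head?, x.1 = a) : FreeGroup.IsReduced (l ++ r) := by
  rw [isReduced_append]
  refine ⟨hl, hr, fun x hx y hy e => h1 x hx ?_⟩
  rw [← h2 y hy, e, flip_fst]

lemma Framed.ne_nil {l : List (X × Bool)} (h : Framed K a l) : l ≠ [] := by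
  obtain ⟨t, rfl⟩ := h.head; simp

lemma Framed.head? {l : List (X × Bool)} (h : Framed K a l) :
    ∀ x ∈ l.head?, x.1 = a := by
  obtain ⟨t, rfl⟩ := h.head
  simp

lemma Framed.append {l r : List (X × Bool)} (hl : Framed K a l) (hr : Framed K a r) :
    Framed K a (l ++ r) := by
  refine ⟨framed_junction hl.red hr.red hl.last hr.head?, ?_, ?_, ?_⟩
  · rw [mk_append]; exact mul_mem hl.mem hr.mem
  · obtain ⟨t, e⟩ := hl.head
    exact ⟨t ++ r, by rw [e]; rfl⟩
  · rw [List.getLast?_append_of_ne_nil _ hr.ne_nil]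
    exact hr.last

lemma Framed.cyc {l : List (X × Bool)} (hl : Framed K a l) :
    FreeGroup.IsCyclicallyReduced l := by
  rw [cycReduced_iff_append_self]
  exact (hl.append hl).red

lemma Framed.npow {l : List (X × Bool)} (hl : Framed K a l) (n : ℕ) :
    Framed K a (npow l (n + 1)) := by
  induction n with
  | zero => simpa [WhiteheadS.npow] using hl
  | succ n ih => exact hl.append ih

/-- A nonempty set of vertices permuted by all framed words, which contains all the vertices
from which a suitable framed word can be read. -/
lemma exists_stable_set (hF : S.Folded)
    (hK : ∀ q, Framed K a q → ∃ v, Rd S v q v) (hne : ∃ q, Framed K a q) :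
    ∃ D : Set S.V, D.Nonempty ∧ (∀ q, Framed K a q → ∀ u ∈ D, ∃ v ∈ D, Rd S u q v) ∧
      ∃ q, Framed K a q ∧ ∀ u v, Rd S u q v → u ∈ D := by
  classical
  let dom : List (X × Bool) → Set S.V := fun l => {u | ∃ v, Rd S u l v}
  let im : List (X × Bool) → Set S.V := fun l => {v | ∃ u, Rd S u l v}
  have hex : ∃ n q, Framed K a q ∧ (dom q).ncard = n := by
    obtain ⟨q, hq⟩ := hne
    exact ⟨_, q, hq, rfl⟩
  obtain ⟨q₀, hq₀, hn⟩ := Nat.find_spec hex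
  have hmin : ∀ q, Framed K a q → (dom q₀).ncard ≤ (dom q).ncard := by
    intro q hq
    rw [hn]
    exact Nat.find_min' hex ⟨q, hq, rfl⟩
  have hcard : ∀ l, (im l).ncard = (dom l).ncard := by
    intro l
    symm
    refine Set.ncard_congr (fun u hu => hu.choose) ?_ ?_ ?_
    · intro u hu; exact ⟨u, hu.choose_spec⟩
    · intro u u' hu hu' e
      have h1 := hu.choose_spec
      have h2 := hu'.choose_spec
      rw [← e] at h2
      exact rd_inj hF h1 h2
    · rintro v ⟨u, h⟩
      exact ⟨u, ⟨v, h⟩, rd_det hF (Exists.choose_spec (⟨v, h⟩ : ∃ v, Rd S u l v)) h⟩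
  have hsub : ∀ l r, dom (l ++ r) ⊆ dom l := by
    rintro l r u ⟨v, h⟩
    obtain ⟨w, h, -⟩ := rd_append.1 h
    exact ⟨w, h⟩
  have himdom : ∀ p, Framed K a p → (dom p).ncard = (dom q₀).ncard → ∀ q, Framed K a q →
      dom (p ++ q) = dom p ∧ im p ⊆ dom q := by
    intro p hp hpc q hq
    have e : dom (p ++ q) = dom p :=
      Set.eq_of_subset_of_ncard_le (hsub p q) (hpc ▸ hmin _ (hp.append hq))
    refine ⟨e, ?_⟩
    rintro v ⟨u, h⟩
    have : u ∈ dom (p ++ q) := e ▸ ⟨v, h⟩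
    obtain ⟨w, h'⟩ := this
    obtain ⟨v', h1, h2⟩ := rd_append.1 h'
    obtain rfl := rd_det hF h h1
    exact ⟨w, h2⟩
  have himeq : ∀ p, Framed K a p → (dom p).ncard = (dom q₀).ncard → im p = dom p :=
    fun p hp hpc => Set.eq_of_subset_of_ncard_le (himdom p hp hpc p hp).2 (hcard p).ge
  refine ⟨dom q₀, ?_, ?_, q₀, hq₀, fun u v h => ⟨v, h⟩⟩
  · obtain ⟨v, hv⟩ := hK q₀ hq₀
    exact ⟨v, v, hv⟩
  · intro q hq u hu
    have h0 := himeq q₀ hq₀ rfl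
    have h1 := himdom q₀ hq₀ rfl q hq
    have h2 := himeq _ (hq₀.append hq) (by rw [h1.1])
    obtain ⟨v, hv⟩ := h1.2 (h0 ▸ hu)
    refine ⟨v, ?_, hv⟩
    rw [← h1.1, ← h2]
    rw [← h0] at hu
    obtain ⟨u', hu'⟩ := hu
    exact ⟨u', rd_append.2 ⟨u, hu', hv⟩⟩

end WhiteheadS

namespace WhiteheadS

variable {X : Type} [DecidableEq X] {S : XDigraph X} {A : Set X}
  {K : Subgroup (FreeGroup X)} {a : X}

/-- Every framed word acts on a stable set as a permutation. -/
lemma exists_perm (hF : S.Folded) {D : Set S.V}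
    (hD : ∀ q, Framed K a q → ∀ u ∈ D, ∃ v ∈ D, Rd S u q v) {q : List (X × Bool)}
    (hq : Framed K a q) : ∃ σ : Equiv.Perm D, ∀ u : D, Rd S u q (σ u) := by
  choose f hf hr using hD q hq
  let F : D → D := fun u => ⟨f u u.2, hf u u.2⟩
  have hinj : Function.Injective F := by
    intro u u' e
    have h1 := hr u u.2
    have h2 := hr u' u'.2
    have e' : f u u.2 = f u' u'.2 := congrArg Subtype.val e
    rw [← e'] at h2
    exact Subtype.ext (rd_inj hF h1 h2)
  exact ⟨Equiv.ofBijective F (Finite.injective_iff_bijective.1 hinj), fun u => hr u u.2⟩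

lemma rd_npow {D : Set S.V} {q : List (X × Bool)} {σ : Equiv.Perm D}
    (h : ∀ u : D, Rd S u q (σ u)) (n : ℕ) (u : D) : Rd S u (npow q n) ((σ ^ n) u) := by
  induction n generalizing u with
  | zero => rfl
  | succ n ih => exact rd_append.2 ⟨σ u, h u, ih (σ u)⟩

/-- Every framed word has a framed inverse on a stable set. -/
lemma exists_framed_inverse (hF : S.Folded) {D : Set S.V}
    (hD : ∀ q, Framed K a q → ∀ u ∈ D, ∃ v ∈ D, Rd S u q v) {q : List (X × Bool)}
    (hq : Framed K a q) : ∃ q', Framed K a q' ∧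
      ∀ u ∈ D, Rd S u (q ++ q') u ∧ Rd S u (q' ++ q) u := by
  obtain ⟨σ, hσ⟩ := exists_perm hF hD hq
  obtain ⟨n, hn, e⟩ := (isOfFinOrder_of_finite σ).exists_pow_eq_one
  obtain ⟨n, rfl⟩ := Nat.exists_eq_add_of_lt hn
  have key : ∀ u ∈ D, Rd S u (q ++ npow q (n + n + 1)) u := by
    intro u hu
    have := rd_npow hσ (n + n + 1 + 1) ⟨u, hu⟩
    have e2 : σ ^ (n + n + 1 + 1) = 1 := by
      rw [show n + n + 1 + 1 = (0 + n + 1) * 2 by ring, pow_mul, e, one_pow]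
    rwa [e2] at this
  exact ⟨npow q (n + n + 1), hq.npow _, fun u hu => ⟨key u hu, npow_comm q _ ▸ key u hu⟩⟩

/-- Reduced words can be framed by elements of `K` labeling loops at every vertex of a stable
set. -/
lemma exists_frame (hF : S.Folded) {D : Set S.V}
    (hD : ∀ q, Framed K a q → ∀ u ∈ D, ∃ v ∈ D, Rd S u q v) (haK : FreeGroup.of a ∈ K)
    {h : List (X × Bool)} (hr : FreeGroup.IsReduced h) (hhK : FreeGroup.mk h ∈ K) (h0 : h ≠ [])
    (hh : ∀ x ∈ h.head?, x.1 ≠ a) (hl : ∀ x ∈ h.getLast?, x.1 ≠ a)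
    {e : List (X × Bool)} (he : Framed K a e) (hid : ∀ u ∈ D, Rd S u e u)
    {g : List (X × Bool)} (hg : FreeGroup.IsReduced g) (hg0 : g ≠ []) :
    ∃ z₁ z₂, FreeGroup.mk z₁ ∈ K ∧ FreeGroup.mk z₂ ∈ K ∧
      (∀ u ∈ D, Rd S u z₁ u ∧ Rd S u z₂ u) ∧ Framed ⊤ a (z₁ ++ g ++ z₂) := by
  have haK' : ∀ b, FreeGroup.mk [(a, b)] ∈ K := fun b => (mk_single_mem_iff (a, b)).2 haK
  have hz₁ : ∃ z₁, FreeGroup.mk z₁ ∈ K ∧ (∀ u ∈ D, Rd S u z₁ u) ∧ FreeGroup.IsReduced (z₁ ++ g) ∧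
      ∃ t, z₁ = (a, true) :: t := by
    by_cases hga : ∀ x ∈ g.head?, x.1 = a
    · exact ⟨e, he.mem, hid, framed_junction he.red hg he.last hga, he.head⟩
    have hga' : ∀ x ∈ g.head?, x.1 ≠ a := by
      intro x hx hxa
      apply hga
      intro y hy
      rw [Option.mem_unique hy hx, hxa]
    have hred : FreeGroup.IsReduced (e ++ [(a, true)]) :=
      framed_junction he.red (by simp) he.last (by simp)
    have hq : Framed K a (e ++ [(a, true)] ++ e) := by
      refine ⟨?_, ?_, ?_, ?_⟩
      · refine isReduced_glue hred ?_ (by simp)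
        rw [isReduced_append]
        refine ⟨by simp, he.red, ?_⟩
        obtain ⟨t, et⟩ := he.head
        rw [et]
        simp [flip]
      · simp only [mk_append]
        exact mul_mem (mul_mem he.mem (haK' _)) he.mem
      · obtain ⟨t, et⟩ := he.head
        exact ⟨t ++ [(a, true)] ++ e, by conv_lhs => rw [et]
                                         simp [et]⟩
      · rw [List.getLast?_append_of_ne_nil _ he.ne_nil]
        exact he.last
    obtain ⟨q', hq', hinv⟩ := exists_framed_inverse hF hD hq
    refine ⟨q' ++ e ++ [(a, true)], ?_, ?_, ?_, ?_⟩
    · simp only [mk_append]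
      exact mul_mem (mul_mem hq'.mem he.mem) (haK' _)
    · intro u hu
      have h1 := (hinv u hu).2
      rw [show q' ++ (e ++ [(a, true)] ++ e) = (q' ++ e ++ [(a, true)]) ++ e by simp,
        rd_append] at h1
      obtain ⟨w, h1, h2⟩ := h1
      rwa [rd_inj hF h2 (hid u hu)] at h1
    · have h1 : FreeGroup.IsReduced (q' ++ e ++ [(a, true)]) := by
        rw [List.append_assoc]
        have := isReduced_glue (hq'.append he).red hred he.ne_nil
        simpa using this
      refine isReduced_glue (m := [(a, true)]) h1 ?_ (by simp)
      rw [isReduced_append]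
      refine ⟨by simp, hg, ?_⟩
      simp only [List.getLast?_singleton, Option.mem_some_iff]
      rintro _ rfl y hy rfl
      exact hga' _ hy rfl
    · obtain ⟨t, et⟩ := hq'.head
      exact ⟨t ++ e ++ [(a, true)], by rw [et]; simp⟩
  have hz₂ : ∃ z₂, FreeGroup.mk z₂ ∈ K ∧ (∀ u ∈ D, Rd S u z₂ u) ∧ FreeGroup.IsReduced (g ++ z₂) ∧
      z₂ ≠ [] ∧ ∀ x ∈ z₂.getLast?, x.1 ≠ a := by
    by_cases hga : (a, false) ∈ g.getLast?
    · have h1 : FreeGroup.IsReduced ((a, false) :: h) := by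
        rw [isReduced_cons]
        refine ⟨hr, fun y hy ey => hh y hy ?_⟩
        rw [ey, flip_fst]
      have h2 : FreeGroup.mk ((a, false) :: h) ∈ K := by
        rw [mk_cons]; exact mul_mem (haK' _) hhK
      have h3 : ∀ x ∈ ((a, false) :: h).getLast?, x.1 ≠ a := by
        rw [List.getLast?_cons_of_ne_nil h0]
        exact hl
      have hq : Framed K a (e ++ (a, false) :: h) := by
        refine ⟨framed_junction he.red h1 he.last (by simp), ?_, ?_, ?_⟩
        · rw [mk_append]; exact mul_mem he.mem h2
        · obtain ⟨t, et⟩ := he.head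
          exact ⟨t ++ (a, false) :: h, by rw [et]; rfl⟩
        · rw [List.getLast?_append_of_ne_nil _ (by simp)]
          exact h3
      obtain ⟨q', hq', hinv⟩ := exists_framed_inverse hF hD hq
      have hred := framed_junction h1 hq'.red h3 hq'.head?
      refine ⟨((a, false) :: h) ++ q', ?_, ?_, ?_, by simp, ?_⟩
      · rw [mk_append]; exact mul_mem h2 hq'.mem
      · intro u hu
        have h4 := (hinv u hu).1
        rw [List.append_assoc, rd_append] at h4
        obtain ⟨w, h4, h5⟩ := h4
        rwa [rd_det hF h4 (hid u hu)] at h5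
      · rw [isReduced_append]
        refine ⟨hg, hred, ?_⟩
        intro x hx y hy
        rw [Option.mem_unique hx hga]
        simp at hy
        rw [← hy]
        simp [flip]
      · rw [List.getLast?_append_of_ne_nil _ hq'.ne_nil]
        exact hq'.last
    · refine ⟨e, he.mem, hid, ?_, he.ne_nil, he.last⟩
      rw [isReduced_append]
      refine ⟨hg, he.red, ?_⟩
      obtain ⟨t, et⟩ := he.head
      rw [et]
      simp only [List.head?_cons, Option.mem_some_iff]
      rintro x hx _ rfl ex
      apply hga
      rw [← flip_flip x, ← ex] at hx
      exact hx
  obtain ⟨z₁, hz₁K, hz₁D, hz₁r, t, ht⟩ := hz₁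
  obtain ⟨z₂, hz₂K, hz₂D, hz₂r, hz₂0, hz₂l⟩ := hz₂
  refine ⟨z₁, z₂, hz₁K, hz₂K, fun u hu => ⟨hz₁D u hu, hz₂D u hu⟩,
    isReduced_glue hz₁r hz₂r hg0, Subgroup.mem_top _, ⟨t ++ g ++ z₂, by rw [ht]; rfl⟩, ?_⟩
  rw [List.getLast?_append_of_ne_nil _ hz₂0]
  exact hz₂l

end WhiteheadS

namespace WhiteheadS

variable {X : Type} [DecidableEq X] {S : XDigraph X} {A : Set X}
  {K : Subgroup (FreeGroup X)} {a : X}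

/-- If the loops of `S` read the conjugacy class of a subgroup `K` which contains more than the
powers of an `A`-letter, then `K` itself is the group of loops at some vertex. -/
lemma exists_loops_eq (hF : S.Folded) (hC : S.Connected)
    (hK : ∀ u g, ConjInto (loops hF u) g ↔ ConjInto K g) (hStar : Star A K) (ha : a ∈ A)
    (haK : FreeGroup.of a ∈ K) (hne : ¬ K ≤ Subgroup.zpowers (FreeGroup.of a)) :
    ∃ u, loops hF u = K := by
  obtain ⟨h, hr, hhK, h0, hh, hl⟩ := exists_trimmed haK hne
  have hread : ∀ q, Framed K a q → ∃ v, Rd S v q v := by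
    intro q hq
    obtain ⟨v⟩ := hC.1
    exact (conjInto_loops_iff hF hC v hq.cyc).1 ((hK v _).2 ⟨1, by simpa using hq.mem⟩)
  have hex : Framed K a ((a, true) :: h) := by
    refine ⟨?_, ?_, ⟨h, rfl⟩, by rwa [List.getLast?_cons_of_ne_nil h0]⟩
    · rw [isReduced_cons]
      refine ⟨hr, fun y hy ey => hh y hy ?_⟩
      rw [ey, flip_fst]
    · rw [mk_cons]; exact mul_mem haK hhK
  obtain ⟨D, hne, hD, q₀, hq₀, hq₀D⟩ := exists_stable_set hF hread ⟨_, hex⟩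
  obtain ⟨q₁, hq₁, hinv⟩ := exists_framed_inverse hF hD hq₀
  set e := q₀ ++ q₁ with he_def
  have he : Framed K a e := hq₀.append hq₁
  have hid : ∀ u ∈ D, Rd S u e u := fun u hu => (hinv u hu).1
  have hdom : ∀ u v, Rd S u e v → u ∈ D := by
    intro u v huv
    obtain ⟨w, h1, -⟩ := rd_append.1 huv
    exact hq₀D u w h1
  have hframe := fun {g : List (X × Bool)} => exists_frame (g := g) hF hD haK hr hhK h0 hh hl he hid
  have hcancel : ∀ z₁ g z₂ : List (X × Bool), FreeGroup.mk z₁ ∈ K → FreeGroup.mk z₂ ∈ K →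
      (FreeGroup.mk (z₁ ++ g ++ z₂) ∈ K ↔ FreeGroup.mk g ∈ K) := by
    intro z₁ g z₂ h1 h2
    rw [mk_append, mk_append, Subgroup.mul_mem_cancel_right _ h2,
      Subgroup.mul_mem_cancel_left _ h1]
  have hconj : ∀ (c : FreeGroup X) l, Framed ⊤ a l → c * FreeGroup.mk l * c⁻¹ ∈ K → c ∈ K := by
    intro c l hl hc
    obtain ⟨t, et⟩ := hl.head
    have := hStar.conj c hl.cyc hc [] (a, true) t (by rw [et]; rfl) ha
    rwa [← FreeGroup.one_eq_mk, mul_one] at this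
  have htop : ∀ l, Framed K a l → Framed ⊤ a l :=
    fun l hl => ⟨hl.red, Subgroup.mem_top _, hl.head, hl.last⟩
  have hof : ∀ l, Framed ⊤ a l → FreeGroup.mk l ∈ K → Framed K a l :=
    fun l hl h => ⟨hl.red, h, hl.head, hl.last⟩
  have hle : ∀ u ∈ D, loops hF u ≤ K := by
    intro u hu g hg
    rcases eq_or_ne g.toWord [] with e0 | e0
    · rw [FreeGroup.toWord_eq_nil_iff.1 e0]
      exact one_mem _
    obtain ⟨z₁, z₂, h1, h2, h3, h4⟩ := hframe FreeGroup.isReduced_toWord e0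
    have h5 : Rd S u (z₁ ++ g.toWord ++ z₂) u :=
      rd_append.2 ⟨u, rd_append.2 ⟨u, (h3 u hu).1, hg⟩, (h3 u hu).2⟩
    obtain ⟨c, hc⟩ := (hK u _).1 ((conjInto_loops_iff hF hC u h4.cyc).2 ⟨u, h5⟩)
    have hcK := hconj c _ h4 hc
    rw [Subgroup.mul_mem_cancel_right _ (inv_mem hcK), Subgroup.mul_mem_cancel_left _ hcK,
      hcancel _ _ _ h1 h2, FreeGroup.mk_toWord] at hc
    exact hc
  have htrans : ∀ u ∈ D, ∀ v ∈ D, ∃ q, Framed K a q ∧ Rd S u q v := by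
    intro u hu v hv
    obtain ⟨g, hg⟩ := exists_pth hF hC u v
    rcases eq_or_ne g.toWord [] with e0 | e0
    · unfold Pth at hg
      rw [e0] at hg
      obtain rfl : u = v := hg
      exact ⟨e, he, hid u hu⟩
    obtain ⟨z₁, z₂, h1, h2, h3, h4⟩ := hframe FreeGroup.isReduced_toWord e0
    have hgK : g ∈ K := by
      refine hconj g e (htop e he) (hle u hu ?_)
      exact pth_mul hF (pth_mul hF hg (pth_mk hF (hid v hv))) (pth_inv hg)
    refine ⟨_, hof _ h4 ?_,
      rd_append.2 ⟨v, rd_append.2 ⟨u, (h3 u hu).1, hg⟩, (h3 v hv).2⟩⟩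
    rwa [hcancel _ _ _ h1 h2, FreeGroup.mk_toWord]
  let G : Subgroup (Equiv.Perm D) :=
    { carrier := {σ | ∃ q, Framed K a q ∧ ∀ u : D, Rd S u q (σ u)}
      mul_mem' := by
        rintro σ τ ⟨q, hq, hσ⟩ ⟨r, hr, hτ⟩
        exact ⟨r ++ q, hr.append hq, fun u => rd_append.2 ⟨τ u, hτ u, hσ (τ u)⟩⟩
      one_mem' := ⟨e, he, fun u => hid u u.2⟩
      inv_mem' := by
        rintro σ ⟨q, hq, hσ⟩
        obtain ⟨q', hq', hi⟩ := exists_framed_inverse hF hD hq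
        refine ⟨q', hq', fun u => ?_⟩
        obtain ⟨w, h1, h2⟩ := rd_append.1 (hi (σ⁻¹ u : D) (σ⁻¹ u : D).2).1
        have h3 := hσ (σ⁻¹ u)
        rw [← Equiv.Perm.mul_apply, mul_inv_cancel, Equiv.Perm.one_apply] at h3
        rwa [rd_det hF h1 h3] at h2 }
  have htr : MulAction.IsPretransitive G D := by
    refine ⟨fun u v => ?_⟩
    obtain ⟨q, hq, huv⟩ := htrans u u.2 v v.2
    obtain ⟨σ, hσ⟩ := exists_perm hF hD hq
    exact ⟨⟨σ, q, hq, hσ⟩, Subtype.ext (rd_det hF (hσ u) huv)⟩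
  have hsub : Subsingleton D := by
    refine subsingleton_of_forall_fixed (G := G) ?_
    rintro ⟨σ, q, hq, hσ⟩
    obtain ⟨v, hv⟩ := hread _ (he.append hq)
    obtain ⟨w, h1, h2⟩ := rd_append.1 hv
    have hvD := hdom v w h1
    obtain rfl := rd_det hF (hid v hvD) h1
    exact ⟨⟨v, hvD⟩, Subtype.ext (rd_det hF (hσ ⟨v, hvD⟩) h2)⟩
  obtain ⟨u, hu⟩ := hne
  refine ⟨u, le_antisymm (hle u hu) fun k hk => ?_⟩
  rcases eq_or_ne k.toWord [] with e0 | e0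
  · rw [FreeGroup.toWord_eq_nil_iff.1 e0]
    exact one_mem _
  obtain ⟨z₁, z₂, h1, h2, h3, h4⟩ := hframe FreeGroup.isReduced_toWord e0
  obtain ⟨v, hv, h5⟩ := hD _ (hof _ h4 (by rwa [hcancel _ _ _ h1 h2, FreeGroup.mk_toWord])) u hu
  obtain rfl : u = v := congrArg Subtype.val (Subsingleton.elim (⟨u, hu⟩ : D) ⟨v, hv⟩)
  obtain ⟨w, h6, h7⟩ := rd_append.1 h5
  obtain ⟨w', h8, h9⟩ := rd_append.1 h6
  obtain rfl := rd_det hF (h3 u hu).1 h8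
  obtain rfl := rd_inj hF (h3 u hu).2 h7
  exact h9

/-- Property (S) for a graph reading the conjugacy class of a free product of a group generated
by `A`-letters and a group without `A`-letters of rank at most one. -/
lemma propertyS_of_model (hF : S.Folded) (hC : S.Connected) (hN : S.NoLeaf) {A' : Set X}
    (hA : A' ⊆ A) (hgen : K = Subgroup.closure (FreeGroup.of '' A' ∪ ↑(K ⊓ FB A)))
    (hcard : K ⊓ FB A ≠ ⊥ → Nat.card (↥(K ⊓ FB A) →* Sgn) = 2)
    (hK : ∀ u g, ConjInto (loops hF u) g ↔ ConjInto K g) : PropertyS S A := by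
  have hof : ∀ a ∈ A', FreeGroup.of a ∈ K := by
    intro a ha
    rw [hgen]
    exact Subgroup.subset_closure (Or.inl ⟨a, ha, rfl⟩)
  rcases A'.eq_empty_or_nonempty with rfl | ⟨a, ha⟩
  · refine propertyS_of_cyclic hF hC hN hK ?_ hcard
    rw [Set.image_empty, Set.empty_union, Subgroup.closure_eq] at hgen
    exact inf_eq_left.1 hgen.symm
  by_cases hz : K ≤ Subgroup.zpowers (FreeGroup.of a)
  · exact propertyS_of_letter hF hC hN hK (hA ha) (hof a ha) hz
  have hStar : Star A K := by
    rw [hgen]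
    exact star_closure fun g hg => hg.2
  obtain ⟨u, hu⟩ := exists_loops_eq hF hC hK hStar (hA ha) (hof a ha) hz
  refine propertyS_of_loops hF hC hN hA u (K ⊓ FB A) inf_le_right (hu.trans hgen) ?_
  rwa [hu]

end WhiteheadS

/-- if `T` satisfies Property (S) with partition `X = A ⊔ B` and
`φ = (C, m)` is a type II Whitehead automorphism with `m ∈ B ∪ B⁻¹` whose cut does not
cut `A ∪ A⁻¹`, then `φ(T)` also satisfies Property (S) with the same partition. -/
theorem propertyS_preserved_by_uncut_B_multiplier
    {X : Type} [Fintype X] [DecidableEq X] (T T' : XDigraph X)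
    (H : Subgroup (FreeGroup X)) (A : Set X)
    (hT : CRep T H) (hPS : PropertyS T A)
    (phi : FreeGroup X ≃* FreeGroup X) (C : Finset (X × Bool)) (m : X × Bool)
    (hphi : IsWhiteheadII phi C m) (hm : m.1 ∉ A)
    (hcut : (∀ x ∈ A, (x, true) ∈ C ∧ (x, false) ∈ C) ∨
            (∀ x ∈ A, (x, true) ∉ C ∧ (x, false) ∉ C))
    (hT' : CRep T' (H.map phi.toMonoidHom)) :
    PropertyS T' A := by
  obtain ⟨A', K, hA, hgen, hcard, hK⟩ :=
    WhiteheadS.exists_model hT hPS hphi hm hcut hT'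
  exact WhiteheadS.propertyS_of_model hT'.1 hT'.2.1 hT'.2.2.1 hA hgen hcard hK
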